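/- arXiv:math/0506255 — 2 statements merged into one kernel-verified Lean document; each statement's English description precedes it below -/
import Mathlib

section
/- Let n ≥ 2 and p ∈ [0,1]. The probability that the Erdős–Rényi random graph G(n,p) is connected is at least (1 - (1-p)^(n-1))^(n-1) · (1/n). -/
open MeasureTheory

noncomputable def bern (p : ℝ) : Measure Bool :=
  ENNReal.ofReal p • Measure.dirac true + ENNReal.ofReal (1 - p) • Measure.dirac false

noncomputable def erMeasure (n : ℕ) (p : ℝ) :
    Measure ({e : Sym2 (Fin n) // ¬ e.IsDiag} → Bool) :=
  Measure.pi fun _ => bern p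

def erGraph (n : ℕ) (ω : {e : Sym2 (Fin n) // ¬ e.IsDiag} → Bool) : SimpleGraph (Fin n) :=
  SimpleGraph.fromEdgeSet {e : Sym2 (Fin n) | ∃ h : ¬ e.IsDiag, ω ⟨e, h⟩ = true}

lemma isProbabilityMeasure_bern {p : ℝ} (hp0 : 0 ≤ p) (hp1 : p ≤ 1) :
    IsProbabilityMeasure (bern p) := by
  constructor
  simp [bern, ← ENNReal.ofReal_add hp0 (sub_nonneg.2 hp1)]

lemma bern_real_singleton {p : ℝ} (hp0 : 0 ≤ p) (hp1 : p ≤ 1) (b : Bool) :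
    (bern p).real {b} = if b = true then p else 1 - p := by
  cases b <;> simp [bern, Measure.real, hp0, hp1]

lemma isProbabilityMeasure_erMeasure (n : ℕ) {p : ℝ} (hp0 : 0 ≤ p) (hp1 : p ≤ 1) :
    IsProbabilityMeasure (erMeasure n p) := by
  have := isProbabilityMeasure_bern hp0 hp1
  unfold erMeasure
  infer_instance

lemma iIndepFun_erMeasure (n : ℕ) {p : ℝ} (hp0 : 0 ≤ p) (hp1 : p ≤ 1) :
    ProbabilityTheory.iIndepFun
      (fun (e : {e : Sym2 (Fin n) // ¬ e.IsDiag}) (ω : _ → Bool) => ω e) (erMeasure n p) := by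
  have := isProbabilityMeasure_bern hp0 hp1
  exact ProbabilityTheory.iIndepFun_pi (X := fun _ => id) fun _ => aemeasurable_id

/-- The states of distinct edges prescribed by a set `K` of open ones occur with probability
`p ^ #K * (1 - p) ^ (#κ - #K)`. -/
lemma erMeasure_real_open_iff_mem {n : ℕ} {p : ℝ} (hp0 : 0 ≤ p) (hp1 : p ≤ 1) {κ : Type*}
    [Fintype κ] [DecidableEq κ] {g : κ → {e : Sym2 (Fin n) // ¬ e.IsDiag}}
    (hg : Function.Injective g) (K : Finset κ) :
    (erMeasure n p).real {ω | ∀ i, ω (g i) = true ↔ i ∈ K} =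
      p ^ K.card * (1 - p) ^ (Fintype.card κ - K.card) := by
  have := isProbabilityMeasure_bern hp0 hp1
  have hset : {ω : {e : Sym2 (Fin n) // ¬ e.IsDiag} → Bool | ∀ i, ω (g i) = true ↔ i ∈ K} =
      ⋂ i ∈ (Finset.univ : Finset κ), (fun ω => ω (g i)) ⁻¹' {decide (i ∈ K)} := by
    ext ω
    simp only [Set.mem_ofPred_eq, Finset.mem_univ, Set.iInter_true, Set.mem_iInter,
      Set.mem_preimage, Set.mem_singleton_iff]
    exact forall_congr' fun i => by by_cases h : i ∈ K <;> simp [h]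
  have hmarg (i : κ) (b : Bool) :
      (erMeasure n p).real ((fun ω => ω (g i)) ⁻¹' {b}) = if b = true then p else 1 - p := by
    rw [← bern_real_singleton hp0 hp1]
    exact congrArg ENNReal.toReal
      ((measurePreserving_eval (fun _ => bern p) (g i)).measure_preimage
        (measurableSet_singleton b).nullMeasurableSet)
  rw [hset, Measure.real,
    ((iIndepFun_erMeasure n hp0 hp1).precomp hg).measure_inter_preimage_eq_mul Finset.univ
      (fun _ _ => measurableSet_singleton _), ENNReal.toReal_prod]
  change ∏ i, (erMeasure n p).real _ = _
  simp only [hmarg, decide_eq_true_eq]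
  rw [Finset.prod_ite, Finset.prod_const, Finset.prod_const, Finset.filter_not]
  simp [Finset.card_sdiff]

/-- Events determined by disjoint sets of edges are independent. -/
lemma erMeasure_real_inter_of_dependsOn {n : ℕ} {p : ℝ} (hp0 : 0 ≤ p) (hp1 : p ≤ 1)
    {A B : Set ({e : Sym2 (Fin n) // ¬ e.IsDiag} → Bool)}
    (T : Finset {e : Sym2 (Fin n) // ¬ e.IsDiag})
    (hA : ∀ ω ω', (∀ e ∈ T, ω e = ω' e) → ω ∈ A → ω' ∈ A)
    (hB : ∀ ω ω', (∀ e ∉ T, ω e = ω' e) → ω ∈ B → ω' ∈ B) :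
    (erMeasure n p).real (A ∩ B) = (erMeasure n p).real A * (erMeasure n p).real B := by
  classical
  have hpre {S : Finset {e : Sym2 (Fin n) // ¬ e.IsDiag}}
      {C : Set ({e : Sym2 (Fin n) // ¬ e.IsDiag} → Bool)}
      (hC : ∀ ω ω', (∀ e ∈ S, ω e = ω' e) → ω ∈ C → ω' ∈ C) :
      (fun ω (e : S) => ω e) ⁻¹' ((fun ω (e : S) => ω e) '' C) = C := by
    refine Set.Subset.antisymm ?_ (Set.subset_preimage_image _ _)
    rintro ω' ⟨ω, hω, h⟩
    exact hC ω ω' (fun e he => congrFun h ⟨e, he⟩) hω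
  have hind := (iIndepFun_erMeasure n hp0 hp1).indepFun_finset T Tᶜ disjoint_compl_right
    (fun e => measurable_pi_apply e)
  have := hind.measure_inter_preimage_eq_mul _ _
    (Set.toFinite ((fun ω (e : T) => ω e) '' A)).measurableSet
    (Set.toFinite ((fun ω (e : (Tᶜ : Finset _)) => ω e) '' B)).measurableSet
  rw [hpre hA, hpre (fun ω ω' h => hB ω ω' fun e he => h e (Finset.mem_compl.2 he))] at this
  simp [Measure.real, this]

lemma erGraph_adj_iff {n : ℕ} {ω : {e : Sym2 (Fin n) // ¬ e.IsDiag} → Bool} {x y : Fin n} :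
    (erGraph n ω).Adj x y ↔ ∃ h : ¬ s(x, y).IsDiag, ω ⟨s(x, y), h⟩ = true := by
  simp only [erGraph, SimpleGraph.fromEdgeSet_adj, Set.mem_ofPred_eq]
  exact and_iff_left_of_imp fun ⟨h, _⟩ => by simpa using h

/-- The event that `J` is the set of neighbours of `v` among the vertices of `U`. -/
def neighborsEvent {n : ℕ} (v : Fin n) (U J : Finset (Fin n)) :
    Set ({e : Sym2 (Fin n) // ¬ e.IsDiag} → Bool) :=
  {ω | ∀ u ∈ U, (erGraph n ω).Adj v u ↔ u ∈ J}

/-- The event that every vertex of `U` is joined to some vertex of `S` by a path inside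
`S ∪ U`. -/
def coverEvent {n : ℕ} (S U : Finset (Fin n)) :
    Set ({e : Sym2 (Fin n) // ¬ e.IsDiag} → Bool) :=
  {ω | ∀ u ∈ U, ∃ s ∈ S, Relation.ReflTransGen
    (fun x y => x ∈ S ∪ U ∧ y ∈ S ∪ U ∧ (erGraph n ω).Adj x y) s u}

lemma erMeasure_real_neighborsEvent {n : ℕ} {p : ℝ} (hp0 : 0 ≤ p) (hp1 : p ≤ 1) {v : Fin n}
    {U J : Finset (Fin n)} (hv : v ∉ U) (hJ : J ⊆ U) :
    (erMeasure n p).real (neighborsEvent v U J) = p ^ J.card * (1 - p) ^ (U.card - J.card) := by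
  have hdiag (u : U) : ¬ s(v, (u : Fin n)).IsDiag := by
    rw [Sym2.mk_isDiag_iff]
    rintro rfl
    exact hv u.2
  have hinj : Function.Injective
      fun u : U => (⟨s(v, (u : Fin n)), hdiag u⟩ : {e : Sym2 (Fin n) // ¬ e.IsDiag}) := by
    intro u w h
    exact Subtype.ext (Sym2.congr_right.1 (Subtype.ext_iff.1 h))
  have hcard : (J.subtype (· ∈ U)).card = J.card := by
    rw [Finset.card_subtype, Finset.filter_true_of_mem fun u hu => hJ hu]
  have := erMeasure_real_open_iff_mem hp0 hp1 hinj (J.subtype (· ∈ U))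
  rw [hcard, Fintype.card_coe] at this
  rw [← this]
  congr 1
  ext ω
  simp only [neighborsEvent, Set.mem_ofPred_eq, Subtype.forall, Finset.mem_subtype,
    erGraph_adj_iff]
  refine forall₂_congr fun u hu => ?_
  rw [exists_prop_of_true (hdiag ⟨u, hu⟩)]

lemma neighborsEvent_inter_coverEvent_subset {n : ℕ} {v : Fin n} {S U J : Finset (Fin n)}
    (hv : v ∈ S) (hJ : J ⊆ U) :
    neighborsEvent v U J ∩ coverEvent (S.erase v ∪ J) (U \ J) ⊆ coverEvent S U := by
  rintro ω ⟨hN, hC⟩ u hu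
  have hstep {w : Fin n} (hw : w ∈ J) :
      v ∈ S ∪ U ∧ w ∈ S ∪ U ∧ (erGraph n ω).Adj v w :=
    ⟨Finset.mem_union_left _ hv, Finset.mem_union_right _ (hJ hw), (hN w (hJ hw)).2 hw⟩
  by_cases huJ : u ∈ J
  · exact ⟨v, hv, .single (hstep huJ)⟩
  obtain ⟨s, hs, hsu⟩ := hC u (Finset.mem_sdiff.2 ⟨hu, huJ⟩)
  have hsub : S.erase v ∪ J ∪ U \ J ⊆ S ∪ U := by
    intro x
    simp only [Finset.mem_union, Finset.mem_erase, Finset.mem_sdiff]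
    have := @hJ x
    tauto
  have hsu' : Relation.ReflTransGen
      (fun x y => x ∈ S ∪ U ∧ y ∈ S ∪ U ∧ (erGraph n ω).Adj x y) s u :=
    Relation.ReflTransGen.mono (fun _ _ h => ⟨hsub h.1, hsub h.2.1, h.2.2⟩) _ _ hsu
  rcases Finset.mem_union.1 hs with hs | hs
  · exact ⟨s, Finset.mem_of_mem_erase hs, hsu'⟩
  · exact ⟨v, hv, .head (hstep hs) hsu'⟩

lemma erMeasure_real_neighborsEvent_inter_coverEvent {n : ℕ} {p : ℝ} (hp0 : 0 ≤ p)
    (hp1 : p ≤ 1) {v : Fin n} {U J S' U' : Finset (Fin n)} (hv : v ∉ S' ∪ U') :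
    (erMeasure n p).real (neighborsEvent v U J ∩ coverEvent S' U') =
      (erMeasure n p).real (neighborsEvent v U J) * (erMeasure n p).real (coverEvent S' U') := by
  refine erMeasure_real_inter_of_dependsOn hp0 hp1
    (Finset.univ.filter fun e => v ∈ (e : Sym2 (Fin n))) ?_ ?_
  · intro ω ω' h hω u hu
    rw [← hω u hu]
    simp only [erGraph_adj_iff]
    exact exists_congr fun hd => by rw [h ⟨s(v, u), hd⟩ (by simp)]
  · intro ω ω' h hω u hu
    obtain ⟨s, hs, hsu⟩ := hω u hu
    refine ⟨s, hs, Relation.ReflTransGen.mono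
      (fun x y hxy => ⟨hxy.1, hxy.2.1, ?_⟩) _ _ hsu⟩
    obtain ⟨hd, he⟩ := erGraph_adj_iff.1 hxy.2.2
    refine erGraph_adj_iff.2 ⟨hd, ?_⟩
    rw [← h ⟨s(x, y), hd⟩ ?_, he]
    simp only [Finset.mem_filter, Finset.mem_univ, true_and, Sym2.mem_iff]
    rintro (rfl | rfl)
    · exact hv hxy.1
    · exact hv hxy.2.1

lemma sum_powerset_card_mul_pow_mul_pow {α : Type*} (U : Finset α) (x y : ℝ) :
    ∑ J ∈ U.powerset, (J.card : ℝ) * (x ^ J.card * y ^ (U.card - J.card)) =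
      U.card * x * (x + y) ^ (U.card - 1) := by
  rw [Finset.sum_powerset_apply_card fun k => (k : ℝ) * (x ^ k * y ^ (U.card - k))]
  rcases U.card with _ | m
  · simp
  rw [Finset.sum_range_succ', add_pow, Finset.mul_sum]
  simp only [nsmul_eq_mul, Nat.cast_zero, zero_mul, mul_zero, add_zero, Nat.add_sub_cancel,
    Nat.add_sub_add_right]
  refine Finset.sum_congr rfl fun k _ => ?_
  have : ((m + 1 : ℕ) : ℝ) * m.choose k = (m + 1).choose (k + 1) * ((k + 1 : ℕ) : ℝ) := by
    exact_mod_cast Nat.add_one_mul_choose_eq m k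
  calc _ = ((m + 1).choose (k + 1) * ((k + 1 : ℕ) : ℝ)) * x ^ (k + 1) * y ^ (m - k) := by ring
    _ = _ := by rw [← this]; ring

/-- The recursion step for the lower bound on the probability of `coverEvent`, with `a + 1` roots
and `#U` vertices to reach. -/
lemma le_sum_powerset_cover_bound {α : Type*} {p : ℝ} (hp0 : 0 ≤ p) (hp1 : p ≤ 1) (a : ℕ)
    {U : Finset α} (hU : U.Nonempty) :
    ((a + 1 : ℕ) : ℝ) / (a + 1 + U.card : ℕ) * (1 - (1 - p) ^ (a + U.card)) ^ U.card ≤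
      ∑ J ∈ U.powerset, p ^ J.card * (1 - p) ^ (U.card - J.card) *
        (((a + J.card : ℕ) : ℝ) / (a + U.card : ℕ) *
          (1 - (1 - p) ^ (a + U.card - 1)) ^ (U.card - J.card)) := by
  have hpos := hU.card_pos
  obtain ⟨m, hm⟩ : ∃ m, U.card = m + 1 := ⟨U.card - 1, by omega⟩
  set s : ℝ := 1 - (1 - p) ^ (a + U.card) with hs
  set y : ℝ := (1 - p) * (1 - (1 - p) ^ (a + U.card - 1)) with hy
  have hxy : p + y = s := by
    rw [hy, hs, hm, ← add_assoc, Nat.add_sub_cancel, pow_succ]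
    ring
  have hs0 : 0 ≤ s := sub_nonneg.2 (pow_le_one₀ (by linarith) (by linarith))
  have hsum : ∑ J ∈ U.powerset, p ^ J.card * (1 - p) ^ (U.card - J.card) *
        (((a + J.card : ℕ) : ℝ) / (a + U.card : ℕ) *
          (1 - (1 - p) ^ (a + U.card - 1)) ^ (U.card - J.card)) =
      (a * s ^ U.card + U.card * p * s ^ (U.card - 1)) / (a + U.card : ℕ) := by
    rw [← hxy, ← sum_powerset_card_mul_pow_mul_pow, ← Finset.sum_pow_mul_eq_add_pow,
      Finset.mul_sum, ← Finset.sum_add_distrib, Finset.sum_div]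
    refine Finset.sum_congr rfl fun J _ => ?_
    rw [hy, mul_pow]
    push_cast
    ring
  have hbern : s ≤ (a + U.card + 1) * p := by
    have := one_add_mul_le_pow (a := -p) (by linarith) (a + U.card)
    rw [← sub_eq_add_neg] at this
    push_cast at this
    rw [hs]
    linarith
  rw [hsum, hm, Nat.add_sub_cancel, pow_succ]
  rw [hm] at hbern
  push_cast at hbern ⊢
  have ha : (0 : ℝ) ≤ a := a.cast_nonneg
  have hm0 : (0 : ℝ) ≤ m := m.cast_nonneg
  rw [div_mul_eq_mul_div, div_le_div_iff₀ (by positivity) (by positivity)]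
  have := mul_le_mul_of_nonneg_left hbern
    (show 0 ≤ ((m : ℝ) + 1) * s ^ m by positivity)
  linarith

theorem le_erMeasure_real_coverEvent {n : ℕ} {p : ℝ} (hp0 : 0 ≤ p) (hp1 : p ≤ 1)
    (S U : Finset (Fin n)) (hSU : Disjoint S U) :
    (S.card : ℝ) / (S.card + U.card : ℕ) * (1 - (1 - p) ^ (S.card + U.card - 1)) ^ U.card ≤
      (erMeasure n p).real (coverEvent S U) := by
  have := isProbabilityMeasure_erMeasure n hp0 hp1
  induction hN : S.card + U.card generalizing S U with
  | zero => simp [show S.card = 0 by omega]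
  | succ N ih =>
  rcases S.eq_empty_or_nonempty with rfl | ⟨v, hv⟩
  · simp
  rcases U.eq_empty_or_nonempty with rfl | hU
  · have : coverEvent S ∅ = Set.univ := by simp [coverEvent]
    rw [this, probReal_univ]
    simpa [← hN] using div_self_le_one _
  have hvU : v ∉ U := Finset.disjoint_left.1 hSU hv
  have herase : (S.erase v).card + 1 = S.card := Finset.card_erase_add_one hv
  have hdisj : Set.PairwiseDisjoint (U.powerset : Set (Finset (Fin n)))
      fun J => neighborsEvent v U J ∩ coverEvent (S.erase v ∪ J) (U \ J) := by
    intro J hJ K hK hJK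
    refine Set.disjoint_left.2 fun ω hωJ hωK => hJK ?_
    rw [Finset.mem_coe, Finset.mem_powerset] at hJ hK
    ext u
    exact ⟨fun hu => (hωK.1 u (hJ hu)).1 ((hωJ.1 u (hJ hu)).2 hu),
      fun hu => (hωJ.1 u (hK hu)).1 ((hωK.1 u (hK hu)).2 hu)⟩
  have hbound := le_sum_powerset_cover_bound hp0 hp1 (S.erase v).card hU
  rw [show (S.erase v).card + 1 + U.card = N + 1 by omega,
    show (S.erase v).card + U.card = N by omega, herase] at hbound
  rw [Nat.add_sub_cancel]
  refine hbound.trans ?_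
  calc _ ≤ ∑ J ∈ U.powerset, (erMeasure n p).real
          (neighborsEvent v U J ∩ coverEvent (S.erase v ∪ J) (U \ J)) := by
        refine Finset.sum_le_sum fun J hJ => ?_
        rw [Finset.mem_powerset] at hJ
        have hJle := Finset.card_le_card hJ
        have hSJ : Disjoint (S.erase v) J :=
          (hSU.mono_left (Finset.erase_subset v S)).mono_right hJ
        have hcardS : (S.erase v ∪ J).card = (S.erase v).card + J.card :=
          Finset.card_union_of_disjoint hSJ
        have hcardU : (U \ J).card = U.card - J.card := Finset.card_sdiff_of_subset hJ
        have hvJ : v ∉ S.erase v ∪ J ∪ U \ J := by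
          simp only [Finset.mem_union, Finset.mem_erase, Finset.mem_sdiff]
          have := @hJ v
          tauto
        rw [erMeasure_real_neighborsEvent_inter_coverEvent hp0 hp1 hvJ,
          erMeasure_real_neighborsEvent hp0 hp1 hvU hJ]
        have hih := ih (S.erase v ∪ J) (U \ J)
          (Finset.disjoint_union_left.2 ⟨(hSU.mono_left (Finset.erase_subset v S)).mono_right
            Finset.sdiff_subset, Finset.disjoint_sdiff⟩) (by omega)
        rw [hcardS, hcardU] at hih
        have : 0 ≤ 1 - p := sub_nonneg.2 hp1
        exact mul_le_mul_of_nonneg_left hih (by positivity)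
    _ = (erMeasure n p).real (⋃ J ∈ U.powerset,
          neighborsEvent v U J ∩ coverEvent (S.erase v ∪ J) (U \ J)) :=
        (measureReal_biUnion_finset hdisj fun _ _ => (Set.toFinite _).measurableSet).symm
    _ ≤ _ := measureReal_mono (Set.iUnion₂_subset fun J hJ =>
        neighborsEvent_inter_coverEvent_subset hv (Finset.mem_powerset.1 hJ))

lemma connected_of_mem_coverEvent {n : ℕ} {r : Fin n}
    {ω : {e : Sym2 (Fin n) // ¬ e.IsDiag} → Bool} (hω : ω ∈ coverEvent {r} {r}ᶜ) :
    (erGraph n ω).Connected := by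
  refine SimpleGraph.connected_iff_exists_forall_reachable _ |>.2 ⟨r, fun u => ?_⟩
  by_cases hu : u = r
  · rw [hu]
  obtain ⟨s, hs, hsu⟩ := hω u (by simpa using hu)
  rw [← Finset.mem_singleton.1 hs, SimpleGraph.reachable_iff_reflTransGen]
  exact Relation.ReflTransGen.mono (fun _ _ h => h.2.2) _ _ hsu

theorem connected_lower_bound (n : ℕ) (hn : 2 ≤ n) (p : ℝ) (hp0 : 0 ≤ p) (hp1 : p ≤ 1) :
    ENNReal.ofReal ((1 - (1 - p) ^ (n - 1)) ^ (n - 1) * (1 / n)) ≤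
    erMeasure n p {ω | (erGraph n ω).Connected} := by
  have := isProbabilityMeasure_erMeasure n hp0 hp1
  have hcover := le_erMeasure_real_coverEvent hp0 hp1 {(⟨0, by omega⟩ : Fin n)} {⟨0, by omega⟩}ᶜ
    disjoint_compl_right
  rw [Finset.card_compl, Finset.card_singleton, Fintype.card_fin,
    show 1 + (n - 1) = n by omega, Nat.cast_one, mul_comm] at hcover
  exact (ENNReal.ofReal_le_of_le_toReal hcover).trans
    (measure_mono fun _ => connected_of_mem_coverEvent)
end

section
/- Let L be the event that G(n, α/n) contains no cycles. Then lim_{n→∞} P(L)^(1/n) = α·exp(-α/2 + 1/(2α)) if α > 1, and = 1 if 0 < α ≤ 1. -/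
open MeasureTheory

section Glue

open scoped Classical
open SimpleGraph

variable {V W : Type*}

lemma exists_map_inl_eq {H : SimpleGraph V} {K : SimpleGraph W} {x y : V ⊕ W}
    (p : (H ⊕g K).Walk x y) : ∀ {a b : V} (ha : x = .inl a) (hb : y = .inl b),
    ∃ q : H.Walk a b, q.map Embedding.sumInl.toHom = p.copy ha hb := by
  induction p with
  | nil =>
    rintro a b rfl hb
    obtain rfl := Sum.inl_injective hb
    exact ⟨.nil, rfl⟩
  | @cons u v w h p ih =>
    rintro a b rfl rfl
    rcases v with v | v
    · obtain ⟨q, hq⟩ := ih rfl rfl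
      refine ⟨.cons (by simpa using h) q, ?_⟩
      rw [Walk.copy_rfl_rfl] at hq ⊢
      subst hq
      rfl
    · simp at h

lemma not_isCycle_inl {H : SimpleGraph V} {K : SimpleGraph W} (hH : H.IsAcyclic) (a : V)
    (c : (H ⊕g K).Walk (.inl a) (.inl a)) : ¬ c.IsCycle := by
  intro hc
  obtain ⟨q, hq⟩ := exists_map_inl_eq c rfl rfl
  refine hH q (Walk.IsCycle.of_map (f := (Embedding.sumInl (H := K)).toHom) ?_)
  rw [hq]
  exact hc

lemma isAcyclic_sum {H : SimpleGraph V} {K : SimpleGraph W} (hH : H.IsAcyclic)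
    (hK : K.IsAcyclic) : (H ⊕g K).IsAcyclic := by
  rintro (a | a) c hc
  · exact not_isCycle_inl hH a c hc
  · exact not_isCycle_inl hK a (c.map (Iso.sumComm (G := H) (H := K)).toHom)
      (hc.map (Iso.sumComm (G := H) (H := K)).injective)

/-- The graph on `V` obtained from graphs on `T` and on its complement, with no edges across. -/
noncomputable def glue (T : Finset V) (H : SimpleGraph {x // x ∉ T})
    (K : SimpleGraph {x // x ∈ T}) : SimpleGraph V :=
  (K ⊕g H).comap (Equiv.sumCompl (· ∈ T)).symm

noncomputable def glueIso (T : Finset V) (H : SimpleGraph {x // x ∉ T})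
    (K : SimpleGraph {x // x ∈ T}) : glue T H K ≃g (K ⊕g H) :=
  Iso.comap (Equiv.sumCompl (· ∈ T)).symm (K ⊕g H)

variable {T : Finset V} {H : SimpleGraph {x // x ∉ T}} {K : SimpleGraph {x // x ∈ T}}

lemma card_edgeSet_glue [Finite V] :
    Nat.card (glue T H K).edgeSet = Nat.card H.edgeSet + Nat.card K.edgeSet := by
  rw [Nat.card_congr ((glueIso T H K).mapEdgeSet.trans edgeSetSumEquiv), Nat.card_sum, add_comm]

lemma glue_adj_of_notMem (x y : {x // x ∉ T}) : (glue T H K).Adj x y ↔ H.Adj x y := by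
  simp [glue, Equiv.sumCompl_symm_apply_of_neg x.2, Equiv.sumCompl_symm_apply_of_neg y.2]

lemma glue_adj_of_mem (x y : {x // x ∈ T}) : (glue T H K).Adj x y ↔ K.Adj x y := by
  simp [glue, Equiv.sumCompl_symm_apply_of_pos x.2, Equiv.sumCompl_symm_apply_of_pos y.2]

lemma comap_glue_notMem : (glue T H K).comap (Subtype.val : {x // x ∉ T} → V) = H := by
  ext x y; exact glue_adj_of_notMem x y

lemma comap_glue_mem : (glue T H K).comap (Subtype.val : {x // x ∈ T} → V) = K := by
  ext x y; exact glue_adj_of_mem x y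

lemma isAcyclic_glue : (glue T H K).IsAcyclic ↔ H.IsAcyclic ∧ K.IsAcyclic := by
  refine ⟨fun h => ⟨?_, ?_⟩, fun h => ?_⟩
  · have := h.of_comap (Function.Embedding.subtype (· ∉ T))
    rwa [Function.Embedding.coe_subtype, comap_glue_notMem] at this
  · have := h.of_comap (Function.Embedding.subtype (· ∈ T))
    rwa [Function.Embedding.coe_subtype, comap_glue_mem] at this
  · exact (glueIso T H K).isAcyclic_iff.2 (isAcyclic_sum h.2 h.1)

lemma reachable_glue_iff (hH : H.Connected) {v : V} (hv : v ∉ T) (x : V) :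
    (glue T H K).Reachable v x ↔ x ∉ T := by
  rw [← (glueIso T H K).reachable_iff]
  change (K ⊕g H).Reachable ((Equiv.sumCompl (· ∈ T)).symm v) ((Equiv.sumCompl (· ∈ T)).symm x) ↔ _
  rw [Equiv.sumCompl_symm_apply_of_neg hv]
  by_cases hx : x ∈ T
  · rw [Equiv.sumCompl_symm_apply_of_pos hx]
    exact iff_of_false (fun h => not_reachable_sum_inl_inr _ _ h.symm) (by simpa)
  · rw [Equiv.sumCompl_symm_apply_of_neg hx]
    exact iff_of_true ((hH.preconnected _ _).map (Embedding.sumInr (G := K)).toHom) hx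

/-- A graph is determined by the component of `v`, the graph induced on it and the graph induced
on the complement. -/
abbrev ComponentData [Fintype V] (v : V) : Type _ :=
  (T : (Finset.univ.erase v).powerset) × {H : SimpleGraph {x // x ∉ T.1} // H.Connected} ×
    SimpleGraph {x // x ∈ T.1}

lemma glue_injective [Fintype V] (v : V) :
    Function.Injective fun D : ComponentData v => glue D.1.1 D.2.1.1 D.2.2 := by
  rintro ⟨⟨T, hT⟩, ⟨H, hH⟩, K⟩ ⟨⟨T', hT'⟩, ⟨H', hH'⟩, K'⟩ h
  dsimp only at h H K H' K' hH hH'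
  have hv : v ∉ T := fun h => by simpa using Finset.mem_powerset.1 hT h
  have hv' : v ∉ T' := fun h => by simpa using Finset.mem_powerset.1 hT' h
  obtain rfl : T = T' := by
    ext x
    rw [← not_iff_not, ← reachable_glue_iff (K := K) hH hv, ← reachable_glue_iff (K := K') hH' hv', h]
  have h1 : H = H' := by
    rw [← comap_glue_notMem (H := H) (K := K), h, comap_glue_notMem]
  have h2 : K = K' := by
    rw [← comap_glue_mem (H := H) (K := K), h, comap_glue_mem]
  subst h1 h2
  rfl

lemma glue_surjective [Fintype V] (v : V) :
    Function.Surjective fun D : ComponentData v => glue D.1.1 D.2.1.1 D.2.2 := by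
  intro G
  let T : Finset V := Finset.univ.filter fun x => ¬ G.Reachable v x
  have hmem : ∀ x, x ∉ T ↔ G.Reachable v x := fun x => by simp [T]
  have hT : T ∈ (Finset.univ.erase v).powerset := by
    rw [Finset.mem_powerset]
    intro x hx
    rw [Finset.mem_erase]
    refine ⟨?_, Finset.mem_univ _⟩
    rintro rfl
    exact (hmem x).2 .rfl hx
  have hconn : (G.comap (Subtype.val : {x // x ∉ T} → V)).Connected := by
    have hset : {x | x ∉ T} = (G.connectedComponentMk v).supp := by
      ext x
      simp only [Set.mem_ofPred_eq, hmem, ConnectedComponent.mem_supp_iff, ConnectedComponent.eq]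
      exact reachable_comm
    have := (G.connectedComponentMk v).connected_toSimpleGraph
    unfold ConnectedComponent.toSimpleGraph at this
    change (G.induce {x | x ∉ T}).Connected
    rw [hset]
    exact this
  refine ⟨⟨⟨T, hT⟩, ⟨_, hconn⟩, G.comap Subtype.val⟩, ?_⟩
  ext x y
  by_cases hx : x ∈ T <;> by_cases hy : y ∈ T
  · exact glue_adj_of_mem ⟨x, hx⟩ ⟨y, hy⟩
  · refine iff_of_false ?_ fun h =>
      (hmem x).2 (((hmem y).1 hy).trans h.symm.reachable) hx
    simp [glue, Equiv.sumCompl_symm_apply_of_pos hx, Equiv.sumCompl_symm_apply_of_neg hy]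
  · refine iff_of_false ?_ fun h =>
      (hmem y).2 (((hmem x).1 hx).trans h.reachable) hy
    simp [glue, Equiv.sumCompl_symm_apply_of_neg hx, Equiv.sumCompl_symm_apply_of_pos hy]
  · exact glue_adj_of_notMem ⟨x, hx⟩ ⟨y, hy⟩

/-- Summation over all graphs by the component of a vertex. -/
lemma sum_simpleGraph_eq_sum_glue [Fintype V] (v : V) (f : SimpleGraph V → ℝ) :
    ∑ G, f G = ∑ T ∈ (Finset.univ.erase v).powerset,
      ∑ H : SimpleGraph {x // x ∉ T} with H.Connected, ∑ K, f (glue T H K) := by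
  rw [← (Equiv.ofBijective _ ⟨glue_injective v, glue_surjective v⟩).sum_comp f,
    Fintype.sum_sigma, ← Finset.sum_coe_sort (Finset.powerset _)]
  refine Finset.sum_congr rfl fun T _ => ?_
  rw [Fintype.sum_prod_type,
    Finset.sum_subtype (p := fun H : SimpleGraph {x // x ∉ T.1} => H.Connected) _ (by simp)]
  rfl

end Glue

section Weights

open scoped Classical
open SimpleGraph

/-- The sum of `r ^ e(G)` over forests `G` on `V`. -/
noncomputable def forestSum (V : Type*) [Fintype V] (r : ℝ) : ℝ :=
  ∑ G : SimpleGraph V with G.IsAcyclic, r ^ Nat.card G.edgeSet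

/-- The sum of `r ^ e(G)` over all graphs `G` on `V`. -/
noncomputable def graphSum (V : Type*) [Fintype V] (r : ℝ) : ℝ :=
  ∑ G : SimpleGraph V, r ^ Nat.card G.edgeSet

/-- The number of trees on `V`. -/
noncomputable def treeCount (V : Type*) [Fintype V] : ℕ :=
  (Finset.univ.filter fun G : SimpleGraph V => G.IsTree).card

variable {V W : Type*} [Fintype V] [Fintype W]

noncomputable def simpleGraphIso (e : V ≃ W) (G : SimpleGraph V) : e.simpleGraph G ≃g G :=
  Iso.comap e.symm G

lemma forestSum_congr (e : V ≃ W) (r : ℝ) : forestSum V r = forestSum W r := by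
  unfold forestSum
  refine Finset.sum_equiv e.simpleGraph (fun G => ?_) fun G _ => ?_
  · simpa using (simpleGraphIso e G).isAcyclic_iff.symm
  · rw [Nat.card_congr (simpleGraphIso e G).mapEdgeSet]

lemma graphSum_congr (e : V ≃ W) (r : ℝ) : graphSum V r = graphSum W r := by
  unfold graphSum
  refine Fintype.sum_equiv e.simpleGraph _ _ fun G => ?_
  rw [Nat.card_congr (simpleGraphIso e G).mapEdgeSet]

lemma treeCount_congr (e : V ≃ W) : treeCount V = treeCount W := by
  unfold treeCount
  refine Finset.card_equiv e.simpleGraph fun G => ?_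
  simpa using (simpleGraphIso e G).isTree_iff.symm

lemma sum_isTree (V : Type*) [Fintype V] (r : ℝ) :
    ∑ G : SimpleGraph V with G.IsTree, r ^ Nat.card G.edgeSet =
      treeCount V * r ^ (Fintype.card V - 1) := by
  rw [treeCount, ← nsmul_eq_mul, ← Finset.sum_const]
  refine Finset.sum_congr rfl fun G hG => ?_
  have := (isTree_iff_connected_and_card.1 (Finset.mem_filter.1 hG).2).2
  rw [Nat.card_eq_fintype_card (α := V)] at this
  rw [← this, Nat.add_sub_cancel]

lemma forestSum_nonneg {r : ℝ} (hr : 0 ≤ r) : 0 ≤ forestSum V r :=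
  Finset.sum_nonneg fun _ _ => by positivity

lemma sum_powerset_erase_eq {n : ℕ} (v : V) (hV : Fintype.card V = n + 1) (f : ℕ → ℝ) :
    ∑ T ∈ (Finset.univ.erase v).powerset, f T.card =
      ∑ k ∈ Finset.range (n + 1), n.choose k * f k := by
  rw [Finset.sum_powerset_apply_card, Finset.card_erase_of_mem (Finset.mem_univ _),
    Finset.card_univ, hV]
  simp

lemma card_equivs {n : ℕ} (hV : Fintype.card V = n + 1) (T : Finset V) :
    Nonempty ({x // x ∉ T} ≃ Fin (n + 1 - T.card)) ∧ Nonempty ({x // x ∈ T} ≃ Fin T.card) :=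
  ⟨⟨Fintype.equivFinOfCardEq (by simp [Fintype.card_subtype_compl, hV])⟩,
    ⟨Fintype.equivFinOfCardEq (by simp)⟩⟩

lemma sum_connected_sum_isAcyclic {A B : Type*} [Fintype A] [Fintype B]
    [iA : Fintype (SimpleGraph A)] [iB : Fintype (SimpleGraph B)] (r : ℝ) :
    ∑ H : SimpleGraph A with H.Connected, ∑ K : SimpleGraph B,
      (if H.IsAcyclic ∧ K.IsAcyclic then r ^ (Nat.card H.edgeSet + Nat.card K.edgeSet) else 0) =
        treeCount A * r ^ (Fintype.card A - 1) * forestSum B r := by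
  obtain rfl : iA = instFintypeSimpleGraphOfDecidableEq := Subsingleton.elim _ _
  obtain rfl : iB = instFintypeSimpleGraphOfDecidableEq := Subsingleton.elim _ _
  rw [← sum_isTree, forestSum, Finset.sum_mul_sum, Finset.sum_filter, Finset.sum_filter]
  refine Finset.sum_congr rfl fun H _ => ?_
  by_cases hH : H.Connected
  · by_cases hA : H.IsAcyclic
    · rw [if_pos hH, if_pos ⟨hH, hA⟩, Finset.sum_filter]
      refine Finset.sum_congr rfl fun K _ => ?_
      simp [hA, pow_add]
    · rw [if_pos hH, if_neg fun h => hA h.isAcyclic]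
      simp [hA]
  · rw [if_neg hH, if_neg fun h => hH h.1]

lemma le_sum_connected_sum {A B : Type*} [Fintype A] [Fintype B]
    [iA : Fintype (SimpleGraph A)] [iB : Fintype (SimpleGraph B)] {r : ℝ} (hr : 0 ≤ r) :
    treeCount A * r ^ (Fintype.card A - 1) * graphSum B r ≤
      ∑ H : SimpleGraph A with H.Connected, ∑ K : SimpleGraph B,
        r ^ (Nat.card H.edgeSet + Nat.card K.edgeSet) := by
  obtain rfl : iA = instFintypeSimpleGraphOfDecidableEq := Subsingleton.elim _ _
  obtain rfl : iB = instFintypeSimpleGraphOfDecidableEq := Subsingleton.elim _ _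
  rw [← sum_isTree, graphSum, Finset.sum_mul_sum]
  simp only [pow_add]
  refine Finset.sum_le_sum_of_subset_of_nonneg (fun H hH => ?_) fun _ _ _ =>
    Finset.sum_nonneg fun _ _ => by positivity
  simp only [Finset.mem_filter, Finset.mem_univ, true_and] at hH ⊢
  exact hH.1

/-- Decomposition of a forest on `n + 1` vertices according to the component of a vertex. -/
lemma forestSum_succ (n : ℕ) (r : ℝ) : forestSum (Fin (n + 1)) r =
    ∑ k ∈ Finset.range (n + 1), n.choose k *
      (treeCount (Fin (n + 1 - k)) * r ^ (n - k) * forestSum (Fin k) r) := by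
  have hV := Fintype.card_fin (n + 1)
  rw [← sum_powerset_erase_eq (0 : Fin (n + 1)) hV fun k =>
    treeCount (Fin (n + 1 - k)) * r ^ (n - k) * forestSum (Fin k) r, forestSum,
    Finset.sum_filter, sum_simpleGraph_eq_sum_glue 0]
  refine Finset.sum_congr rfl fun T _ => ?_
  obtain ⟨⟨e₁⟩, ⟨e₂⟩⟩ := card_equivs hV T
  simp only [isAcyclic_glue, card_edgeSet_glue]
  refine Eq.trans ?_ ((sum_connected_sum_isAcyclic (A := {x // x ∉ T}) (B := {x // x ∈ T}) r).trans ?_)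
  · congr!
  rw [treeCount_congr e₁, forestSum_congr e₂, Fintype.card_congr e₁,
    Fintype.card_fin, show n + 1 - T.card - 1 = n - T.card by omega]

lemma le_graphSum_succ (n : ℕ) {r : ℝ} (hr : 0 ≤ r) :
    ∑ k ∈ Finset.range (n + 1), n.choose k *
      (treeCount (Fin (n + 1 - k)) * r ^ (n - k) * graphSum (Fin k) r) ≤
        graphSum (Fin (n + 1)) r := by
  have hV := Fintype.card_fin (n + 1)
  rw [← sum_powerset_erase_eq (0 : Fin (n + 1)) hV fun k =>
    treeCount (Fin (n + 1 - k)) * r ^ (n - k) * graphSum (Fin k) r,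
    graphSum, sum_simpleGraph_eq_sum_glue 0]
  refine Finset.sum_le_sum fun T _ => ?_
  obtain ⟨⟨e₁⟩, ⟨e₂⟩⟩ := card_equivs hV T
  simp only [card_edgeSet_glue]
  refine le_trans (le_of_eq ?_)
    ((le_sum_connected_sum (A := {x // x ∉ T}) (B := {x // x ∈ T}) hr).trans_eq ?_)
  swap
  · congr!
  rw [treeCount_congr e₁, graphSum_congr e₂, Fintype.card_congr e₁,
    Fintype.card_fin, show n + 1 - T.card - 1 = n - T.card by omega]

end Weights

section Subcritical

open scoped Classical
open SimpleGraph Finset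

variable {V : Type*}

/-- The graph with edge set `F`. -/
abbrev edgeGraph (F : Finset (Sym2 V)) : SimpleGraph V := fromEdgeSet (F : Set (Sym2 V))

lemma edgeGraph_insert (F : Finset (Sym2 V)) (u v : V) :
    edgeGraph (insert s(u, v) F) = edgeGraph F ⊔ edge u v := by
  rw [edgeGraph, edgeGraph, edge, ← fromEdgeSet_union, coe_insert, Set.union_comm, Set.insert_eq]

/-- The forests with edges in `E`. -/
noncomputable def forestsIn (E : Finset (Sym2 V)) : Finset (Finset (Sym2 V)) :=
  {F ∈ E.powerset | (edgeGraph F).IsAcyclic}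

/-- The weight of the forests with edges in `E` that connect `u` and `v`. -/
noncomputable def linkSum [Fintype V] (E : Finset (Sym2 V)) (r : ℝ) (u v : V) : ℝ :=
  ∑ F ∈ forestsIn E with (edgeGraph F).Reachable u v, r ^ F.card

lemma exists_adj_reachable_erase {F : Finset (Sym2 V)} {u v : V} (huv : u ≠ v)
    (h : (edgeGraph F).Reachable u v) :
    ∃ w, s(u, w) ∈ F ∧ (edgeGraph (F.erase s(u, w))).Reachable w v := by
  obtain ⟨p, hp⟩ := h.exists_isPath
  cases p with
  | nil => exact absurd rfl huv
  | @cons _ w _ hadj q =>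
    rw [Walk.cons_isPath_iff] at hp
    refine ⟨w, (fromEdgeSet_adj _).1 hadj |>.1, ?_⟩
    have := (q.toDeleteEdges {s(u, w)} fun e he => by
      rintro rfl
      exact hp.2 (q.fst_mem_support_of_mem_edges he)).reachable
    rwa [deleteEdges, ← fromEdgeSet_sdiff, ← coe_erase] at this

lemma linkSum_le_sum [Fintype V] (E : Finset (Sym2 V)) {r : ℝ} (hr : 0 ≤ r) {u v : V}
    (huv : u ≠ v) : linkSum E r u v ≤ r * ∑ w, linkSum E r w v := by
  have hstep : ∀ F ∈ forestsIn E, (edgeGraph F).Reachable u v →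
      r ^ F.card ≤ ∑ w, if s(u, w) ∈ F ∧
        (edgeGraph (F.erase s(u, w))).Reachable w v then r ^ F.card else 0 := by
    intro F _ h
    obtain ⟨w, hw⟩ := exists_adj_reachable_erase huv h
    refine le_trans (by rw [if_pos hw]) (single_le_sum (f := fun w => if s(u, w) ∈ F ∧
        (edgeGraph (F.erase s(u, w))).Reachable w v then r ^ F.card else 0)
        (fun w _ => ?_) (mem_univ w))
    split_ifs <;> positivity
  calc linkSum E r u v
      ≤ ∑ F ∈ forestsIn E, ∑ w, if s(u, w) ∈ F ∧
        (edgeGraph (F.erase s(u, w))).Reachable w v then r ^ F.card else 0 := by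
        rw [linkSum, sum_filter]
        refine sum_le_sum fun F hF => ?_
        split_ifs with h
        · exact hstep F hF h
        · refine sum_nonneg fun w _ => ?_
          split_ifs <;> positivity
    _ = ∑ w, ∑ F ∈ forestsIn E with s(u, w) ∈ F ∧
        (edgeGraph (F.erase s(u, w))).Reachable w v, r ^ F.card := by
        rw [sum_comm]
        simp only [sum_filter]
    _ ≤ ∑ w, r * linkSum E r w v := by
        refine sum_le_sum fun w _ => ?_
        rw [linkSum, mul_sum]
        have hinj : Set.InjOn (fun F : Finset (Sym2 V) => F.erase s(u, w))
            ({F ∈ forestsIn E | s(u, w) ∈ F ∧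
              (edgeGraph (F.erase s(u, w))).Reachable w v} :
                Finset (Finset (Sym2 V))) := by
          intro F hF F' hF' h
          simp only [coe_filter, Set.mem_ofPred_eq] at hF hF'
          exact erase_injOn' _ hF.2.1 hF'.2.1 h
        calc _ = ∑ F ∈ ({F ∈ forestsIn E | s(u, w) ∈ F ∧
              (edgeGraph (F.erase s(u, w))).Reachable w v}).image
                (fun F => F.erase s(u, w)), r * r ^ F.card := by
              rw [sum_image hinj]
              refine sum_congr rfl fun F hF => ?_
              rw [← pow_succ', card_erase_add_one (mem_filter.1 hF).2.1]
          _ ≤ _ := by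
              refine sum_le_sum_of_subset_of_nonneg ?_ fun _ _ _ => by positivity
              intro F hF
              obtain ⟨F', hF', rfl⟩ := mem_image.1 hF
              rw [mem_filter, forestsIn, mem_filter, mem_powerset] at hF'
              rw [mem_filter, forestsIn, mem_filter, mem_powerset]
              exact ⟨⟨(erase_subset _ _).trans hF'.1.1,
                hF'.1.2.anti (fromEdgeSet_mono (coe_subset.2 (erase_subset _ _)))⟩, hF'.2.2⟩
    _ = r * ∑ w, linkSum E r w v := by rw [mul_sum]

lemma linkSum_le [Fintype V] (E : Finset (Sym2 V)) {r : ℝ} (hr : 0 ≤ r)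
    (hr1 : r * Fintype.card V < 1) {u v : V} (huv : u ≠ v) :
    linkSum E r u v ≤ r / (1 - r * Fintype.card V) * ∑ F ∈ forestsIn E, r ^ F.card := by
  set Z := ∑ F ∈ forestsIn E, r ^ F.card
  set S := ∑ w, linkSum E r w v
  have hS0 : 0 ≤ S := sum_nonneg fun _ _ => sum_nonneg fun _ _ => by positivity
  have hS : S ≤ Z + r * Fintype.card V * S := by
    have hvv : linkSum E r v v = Z := by simp [linkSum, Z]
    calc S = linkSum E r v v + ∑ w ∈ univ.erase v, linkSum E r w v :=
          (add_sum_erase _ _ (mem_univ v)).symm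
      _ ≤ Z + ∑ w ∈ univ.erase v, r * S := by
          rw [hvv]
          gcongr with w hw
          exact linkSum_le_sum E hr (ne_of_mem_erase hw)
      _ ≤ Z + ∑ _w : V, r * S := by
          gcongr
          exact erase_subset _ _
      _ = _ := by simp; ring
  have hpos : 0 < 1 - r * Fintype.card V := by linarith
  calc linkSum E r u v ≤ r * S := linkSum_le_sum E hr huv
    _ ≤ r * (Z / (1 - r * Fintype.card V)) := by
        gcongr
        rw [le_div_iff₀ hpos]
        linarith
    _ = _ := by ring

lemma pow_card_le_sum_forestsIn [Fintype V] {r : ℝ} (hr : 0 ≤ r)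
    (hr1 : r * Fintype.card V < 1) (hr2 : 0 ≤ 1 + r - r * (r / (1 - r * Fintype.card V)))
    (E : Finset (Sym2 V)) (hE : ∀ e ∈ E, ¬ e.IsDiag) :
    (1 + r - r * (r / (1 - r * Fintype.card V))) ^ E.card ≤ ∑ F ∈ forestsIn E, r ^ F.card := by
  induction E using Finset.induction_on with
  | empty => simp [forestsIn, filter_singleton, edgeGraph]
  | insert e E he ih =>
    induction e using Sym2.ind with
    | _ u v =>
    have huv : u ≠ v := by simpa using hE s(u, v) (mem_insert_self _ _)
    have ih := ih fun e h => hE e (mem_insert_of_mem h)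
    set q := r / (1 - r * Fintype.card V) with hq
    have hlink := linkSum_le E hr hr1 huv
    have hacyc : ∀ F ∈ E.powerset, ((edgeGraph (insert s(u, v) F)).IsAcyclic ↔
        (edgeGraph F).IsAcyclic ∧
          ¬ (edgeGraph F).Reachable u v) := by
      intro F hF
      have hnot : s(u, v) ∉ F := fun h => he (mem_powerset.1 hF h)
      rw [edgeGraph_insert, isAcyclic_sup_fromEdgeSet_iff]
      simp [huv, hnot]
    have hsum : ∑ F ∈ forestsIn (insert s(u, v) E), r ^ F.card =
        (1 + r) * ∑ F ∈ forestsIn E, r ^ F.card - r * linkSum E r u v := by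
      have hinsert : ∀ F ∈ E.powerset, (if (edgeGraph (insert s(u, v) F)).IsAcyclic
          then r ^ (insert s(u, v) F).card else 0) =
          r * (if (edgeGraph F).IsAcyclic then r ^ F.card else 0) -
          r * (if (edgeGraph F).IsAcyclic then
            if (edgeGraph F).Reachable u v then r ^ F.card else 0 else 0) := by
        intro F hF
        have hnot : s(u, v) ∉ F := fun h => he (mem_powerset.1 hF h)
        simp only [hacyc F hF, card_insert_of_notMem hnot]
        by_cases h1 : (edgeGraph F).IsAcyclic <;>
        by_cases h2 : (edgeGraph F).Reachable u v <;> simp [h1, h2, pow_succ']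
      rw [linkSum, sum_filter, forestsIn, forestsIn, sum_filter, sum_filter, sum_filter,
        sum_powerset_insert he, sum_congr rfl hinsert, sum_sub_distrib, ← mul_sum, ← mul_sum]
      ring
    rw [card_insert_of_notMem he, pow_succ, hsum]
    nlinarith [mul_le_mul_of_nonneg_right ih hr2, mul_le_mul_of_nonneg_left hlink hr]

lemma forestSum_eq_sum_forestsIn [Fintype V] (r : ℝ) :
    forestSum V r = ∑ F ∈ forestsIn (univ.filter fun e : Sym2 V => ¬ e.IsDiag), r ^ F.card := by
  rw [forestSum]
  refine sum_bij' (fun G _ => G.edgeFinset) (fun F _ => fromEdgeSet ↑F) ?_ ?_ ?_ ?_ ?_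
  · intro G hG
    simp only [forestsIn, mem_filter, mem_powerset]
    refine ⟨fun e he => ?_, ?_⟩
    swap
    · rw [edgeGraph, coe_edgeFinset, fromEdgeSet_edgeSet]
      exact (mem_filter.1 hG).2
    simpa using G.not_isDiag_of_mem_edgeFinset he
  · intro F hF
    simpa using (mem_filter.1 hF).2
  · intro G _
    simp
  · intro F hF
    have hF := mem_powerset.1 (mem_filter.1 hF).1
    rw [← coe_inj, coe_edgeFinset, edgeSet_fromEdgeSet, sdiff_eq_left, Set.disjoint_left]
    intro e he hd
    exact (mem_filter.1 (hF he)).2 hd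
  · intro G _
    rw [edgeFinset_card, Nat.card_eq_fintype_card]

/-- Below the critical density, almost all of the total weight is carried by forests. -/
lemma pow_le_forestSum [Fintype V] {r : ℝ} (hr : 0 ≤ r) (hr1 : r * Fintype.card V < 1)
    (hr2 : 0 ≤ 1 + r - r * (r / (1 - r * Fintype.card V))) :
    (1 + r - r * (r / (1 - r * Fintype.card V))) ^ (Fintype.card V).choose 2 ≤ forestSum V r := by
  have h := pow_card_le_sum_forestsIn hr hr1 hr2
    (univ.filter fun e : Sym2 V => ¬ e.IsDiag) (by simp)
  rwa [← forestSum_eq_sum_forestsIn, ← Fintype.card_subtype, Sym2.card_subtype_not_diag] at h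

end Subcritical

section Cayley

open scoped Classical
open SimpleGraph Finset

variable {V : Type*}

/-- A partial parent function whose iteration terminates: a rooted forest. -/
def IsRooted (f : V → Option V) : Prop := ∃ h : V → ℕ, ∀ v w, f v = some w → h w < h v

lemma IsRooted.exists_root {f : V → Option V} (hf : IsRooted f) (v : V) :
    ∃ ρ, f ρ = none ∧ Relation.ReflTransGen (fun x y => f x = some y) v ρ := by
  obtain ⟨h, hh⟩ := hf
  induction hn : h v using Nat.strong_induction_on generalizing v with
  | _ n ih =>
    cases hv : f v with
    | none => exact ⟨v, hv, .refl⟩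
    | some w =>
      obtain ⟨ρ, hρ, hw⟩ := ih (h w) (hn ▸ hh v w hv) w rfl
      exact ⟨ρ, hρ, .head hv hw⟩

lemma IsRooted.update {f : V → Option V} (hf : IsRooted f) {ρ v : V} (hρ : f ρ = none)
    (hv : ¬ Relation.ReflTransGen (fun x y => f x = some y) v ρ) :
    IsRooted (Function.update f ρ (some v)) := by
  obtain ⟨h, hh⟩ := hf
  refine ⟨fun x => if Relation.ReflTransGen (fun x y => f x = some y) x ρ then h x + h v + 1
    else h x, fun x y hxy => ?_⟩
  by_cases hx : x = ρ
  · subst hx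
    obtain rfl : v = y := by simpa using hxy
    simp only [if_neg hv, if_pos Relation.ReflTransGen.refl]
    omega
  · rw [Function.update_of_ne hx] at hxy
    have := hh x y hxy
    by_cases hy : Relation.ReflTransGen (fun x y => f x = some y) y ρ
    · have hx' : Relation.ReflTransGen (fun x y => f x = some y) x ρ :=
        Relation.ReflTransGen.head (r := fun x y => f x = some y) hxy hy
      simp only [if_pos hy, if_pos hx']
      omega
    · have : ¬ Relation.ReflTransGen (fun x y => f x = some y) x ρ := by
        intro hxρ
        rcases hxρ.cases_head with rfl | ⟨z, hz, hzρ⟩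
        · exact hx rfl
        · rw [hxy] at hz
          obtain rfl := Option.some_injective _ hz
          exact hy hzρ
      simp only [if_neg hy, if_neg this]
      omega

/-- The graph joining every vertex to its parent. -/
def parentGraph (f : V → Option V) : SimpleGraph V :=
  SimpleGraph.fromRel fun v w => f v = some w

lemma parentGraph_adj {f : V → Option V} (hf : IsRooted f) {v w : V} :
    (parentGraph f).Adj v w ↔ f v = some w ∨ f w = some v := by
  obtain ⟨h, hh⟩ := hf
  simp only [parentGraph, fromRel_adj, ne_eq, and_iff_right_iff_imp]
  rintro (h | h) rfl <;> exact lt_irrefl _ (hh _ _ h)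

variable [Fintype V]

/-- The set of roots of a partial parent function. -/
noncomputable def rootSet (f : V → Option V) : Finset V := univ.filter fun v => f v = none

/-- The rooted forests on `V` with `k` roots. -/
noncomputable def rootedForests (V : Type*) [Fintype V] (k : ℕ) : Finset (V → Option V) :=
  univ.filter fun f => IsRooted f ∧ (rootSet f).card = k

lemma le_card_roots_update {f : V → Option V} (hf : IsRooted f) {k : ℕ}
    (hk : (rootSet f).card = k + 1) (v : V) :
    k ≤ ((rootSet f).filter fun ρ => IsRooted (Function.update f ρ (some v))).card := by
  obtain ⟨ρ₀, hρ₀, hv⟩ := hf.exists_root v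
  have hmem : ρ₀ ∈ rootSet f := by simp [rootSet, hρ₀]
  rw [← Nat.add_sub_cancel k 1, ← hk, ← card_erase_of_mem hmem]
  refine card_le_card fun ρ hρ => ?_
  obtain ⟨hne, hρ⟩ := mem_erase.1 hρ
  have hρn : f ρ = none := by simpa [rootSet] using hρ
  refine mem_filter.2 ⟨hρ, hf.update hρn fun h => hne ?_⟩
  have huniq : Relator.RightUnique fun x y => f x = some y := fun a b c hb hc =>
    Option.some_injective _ (hb.symm.trans hc)
  rcases Relation.ReflTransGen.total_of_right_unique huniq h hv with h | h
  · rcases h.cases_head with rfl | ⟨z, hz, -⟩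
    · rfl
    · simp [hρn] at hz
  · rcases h.cases_head with rfl | ⟨z, hz, -⟩
    · rfl
    · simp [hρ₀] at hz

/-- Joining a root to a vertex of another tree, double counted. -/
lemma card_rootedForests_mul_le (k : ℕ) :
    Fintype.card V * k * (rootedForests V (k + 1)).card ≤
      (Fintype.card V - k) * (rootedForests V k).card := by
  let A : Finset ((V → Option V) × V × V) := (rootedForests V (k + 1) ×ˢ univ).filter fun x =>
    x.1 x.2.1 = none ∧ IsRooted (Function.update x.1 x.2.1 (some x.2.2))
  let B : Finset ((V → Option V) × V) := (rootedForests V k ×ˢ univ).filter fun x => x.1 x.2 ≠ none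
  have hA : Fintype.card V * k * (rootedForests V (k + 1)).card ≤ A.card := by
    have : A.card = ∑ f ∈ rootedForests V (k + 1), ∑ v,
        ((rootSet f).filter fun ρ => IsRooted (Function.update f ρ (some v))).card := by
      simp only [A, rootSet, card_filter, sum_product, filter_filter]
      refine sum_congr rfl fun f _ => ?_
      rw [Fintype.sum_prod_type, sum_comm]
    rw [this, mul_comm, ← smul_eq_mul]
    refine card_nsmul_le_sum _ _ _ fun f hf => ?_
    rw [← smul_eq_mul]
    refine card_nsmul_le_sum _ _ _ fun v _ => ?_
    obtain ⟨-, h1, h2⟩ := mem_filter.1 hf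
    exact le_card_roots_update h1 h2 v
  have hB : B.card = (Fintype.card V - k) * (rootedForests V k).card := by
    have : B.card = ∑ f ∈ rootedForests V k, (univ.filter fun ρ => f ρ ≠ none).card := by
      simp only [B, card_filter, sum_product]
    rw [this, mul_comm, ← smul_eq_mul, ← sum_const]
    refine sum_congr rfl fun f hf => ?_
    obtain ⟨-, h1, h2⟩ := mem_filter.1 hf
    rw [← h2, rootSet, ← card_compl, compl_filter]
  rw [← hB]
  refine hA.trans (card_le_card_of_injOn
    (fun x => (Function.update x.1 x.2.1 (some x.2.2), x.2.1)) ?_ ?_)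
  · rintro ⟨f, ρ, v⟩ hx
    simp only [A, coe_filter, mem_product, mem_univ, and_true, Set.mem_ofPred_eq] at hx
    obtain ⟨hf, hρ, hr⟩ := hx
    obtain ⟨-, h1, h2⟩ := mem_filter.1 hf
    simp only [B, coe_filter, mem_product, mem_univ, and_true, Set.mem_ofPred_eq,
      Function.update_self, ne_eq, reduceCtorEq, not_false_eq_true, rootedForests, mem_filter,
      true_and]
    refine ⟨hr, ?_⟩
    have : rootSet (Function.update f ρ (some v)) = (rootSet f).erase ρ := by
      ext x
      by_cases hx : x = ρ <;> simp [rootSet, hx]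
    rw [this, card_erase_of_mem (by simp [rootSet, hρ]), h2, Nat.add_sub_cancel]
  · rintro ⟨f, ρ, v⟩ hx ⟨f', ρ', v'⟩ hx' h
    simp only [A, coe_filter, Set.mem_ofPred_eq] at hx hx'
    simp only [Prod.mk.injEq] at h
    obtain ⟨h, rfl⟩ := h
    have hv : v = v' := by simpa using congrFun h ρ
    have hf : f = f' := by
      ext1 x
      by_cases hxρ : x = ρ
      · rw [hxρ, hx.2.1, hx'.2.1]
      · simpa [hxρ] using congrFun h x
    rw [hv, hf]

lemma pow_mul_descFactorial_le (n j : ℕ) (hV : Fintype.card V = n + 1) (hj : j ≤ n) :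
    (n + 1) ^ j * n.descFactorial j ≤ (rootedForests V (n + 1 - j)).card * j.factorial := by
  induction j with
  | zero =>
    simp only [pow_zero, Nat.descFactorial_zero, Nat.factorial_zero, mul_one, Nat.sub_zero]
    refine card_pos.2 ⟨fun _ => none, ?_⟩
    simp only [rootedForests, mem_filter, mem_univ, true_and]
    exact ⟨⟨fun _ => 0, by simp⟩, by simp [rootSet, hV]⟩
  | succ j ih =>
    have ih := ih (by omega)
    have h := card_rootedForests_mul_le (V := V) (n - j)
    rw [hV, show n + 1 - (n - j) = j + 1 by omega, show n - j + 1 = n + 1 - j by omega] at h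
    rw [show n + 1 - (j + 1) = n - j by omega, Nat.descFactorial_succ, Nat.factorial_succ]
    calc (n + 1) ^ (j + 1) * ((n - j) * n.descFactorial j)
        = (n + 1) * (n - j) * ((n + 1) ^ j * n.descFactorial j) := by ring
      _ ≤ (n + 1) * (n - j) * ((rootedForests V (n + 1 - j)).card * j.factorial) := by gcongr
      _ = (n + 1) * (n - j) * (rootedForests V (n + 1 - j)).card * j.factorial := by ring
      _ ≤ (j + 1) * (rootedForests V (n - j)).card * j.factorial := by gcongr
      _ = _ := by ring

lemma isTree_parentGraph {f : V → Option V} (hf : IsRooted f) {ρ : V} (hρ : rootSet f = {ρ}) :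
    (parentGraph f).IsTree := by
  have hreach : ∀ v, (parentGraph f).Reachable v ρ := by
    intro v
    obtain ⟨ρ', hρ', hv⟩ := hf.exists_root v
    obtain rfl : ρ' = ρ := by simpa [hρ] using (show ρ' ∈ rootSet f by simp [rootSet, hρ'])
    induction hv using Relation.ReflTransGen.head_induction_on with
    | refl => exact .rfl
    | head h _ ih => exact ((parentGraph_adj hf).2 (.inl h)).reachable.trans ih
  have hconn : (parentGraph f).Connected :=
    (connected_iff _).2 ⟨fun v w => (hreach v).trans (hreach w).symm, ⟨ρ⟩⟩
  rw [isTree_iff_connected_and_card]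
  refine ⟨hconn, le_antisymm ?_ hconn.card_vert_le_card_edgeSet_add_one⟩
  have hsub : (parentGraph f).edgeSet ⊆
      ((univ.erase ρ).image fun v => s(v, (f v).getD v) : Finset (Sym2 V)) := by
    intro e
    induction e using Sym2.ind with
    | _ v w =>
      have key : ∀ v w, f v = some w → s(v, w) ∈
          ((univ.erase ρ).image fun v => s(v, (f v).getD v) : Finset (Sym2 V)) := by
        intro v w h
        refine mem_image.2 ⟨v, mem_erase.2 ⟨?_, mem_univ _⟩, by simp [h]⟩
        rintro rfl
        have : v ∈ rootSet f := by simp [hρ]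
        simp [rootSet, h] at this
      rw [mem_edgeSet, parentGraph_adj hf]
      rintro (h | h)
      · exact key v w h
      · rw [Sym2.eq_swap]
        exact key w v h
  have hcard := Set.ncard_le_ncard hsub (Finset.finite_toSet _)
  rw [Set.ncard_coe_finset] at hcard
  have h1 := hcard.trans card_image_le
  rw [card_erase_of_mem (mem_univ _), card_univ] at h1
  have h2 : 0 < Fintype.card V := Fintype.card_pos_iff.2 ⟨ρ⟩
  rw [Nat.card_eq_fintype_card (α := V)]
  change (parentGraph f).edgeSet.ncard + 1 ≤ _
  omega

lemma parentGraph_injective {f g : V → Option V} (hf : IsRooted f) (hg : IsRooted g)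
    (hroot : rootSet f = rootSet g) (h : parentGraph f = parentGraph g) : f = g := by
  have hnone : ∀ v, f v = none ↔ g v = none := fun v => by
    simpa [rootSet] using congrArg (v ∈ ·) hroot
  have hf' := hf
  obtain ⟨d, hd⟩ := hf'
  funext v
  induction hn : d v using Nat.strong_induction_on generalizing v with
  | _ n ih =>
    cases hv : f v with
    | none => exact ((hnone v).1 hv).symm
    | some w =>
      have hadj : (parentGraph g).Adj v w := h ▸ (parentGraph_adj hf).2 (.inl hv)
      rcases (parentGraph_adj hg).1 hadj with h1 | h1
      · exact h1.symm
      · have hw := ih (d w) (hn ▸ hd v w hv) w rfl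
        rw [h1] at hw
        exact absurd (hd v w hv) (hd w v hw).asymm

/-- The lower bound in the Cayley formula. -/
lemma pow_le_mul_treeCount (n : ℕ) (hV : Fintype.card V = n + 1) :
    (n + 1) ^ n ≤ (n + 1) * treeCount V := by
  have h := pow_mul_descFactorial_le n n hV le_rfl
  rw [Nat.descFactorial_self, Nat.add_sub_cancel_left] at h
  refine (Nat.le_of_mul_le_mul_right h n.factorial_pos).trans ?_
  rw [treeCount, ← hV, ← card_univ, ← card_product]
  have hex : ∀ f ∈ rootedForests V 1, ∃ ρ, rootSet f = {ρ} := fun f hf =>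
    card_eq_one.1 (mem_filter.1 hf).2.2
  have : Nonempty V := Fintype.card_pos_iff.1 (by omega)
  choose! ρ hρ using hex
  refine card_le_card_of_injOn (fun f => (ρ f, parentGraph f)) (fun f hf => ?_) ?_
  · have := isTree_parentGraph (mem_filter.1 hf).2.1 (hρ f hf)
    simpa using this
  · intro f hf g hg h
    simp only [Prod.mk.injEq] at h
    exact parentGraph_injective (mem_filter.1 hf).2.1 (mem_filter.1 hg).2.1
      (by rw [hρ f hf, hρ g hg, h.1]) h.2

end Cayley

section Measure

open SimpleGraph MeasureTheory

variable {n : ℕ}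

lemma edgeSet_erGraph (ω : {e : Sym2 (Fin n) // ¬ e.IsDiag} → Bool) :
    (erGraph n ω).edgeSet = Subtype.val '' {e | ω e = true} := by
  ext e
  simp [erGraph]

lemma erGraph_bijective (n : ℕ) : Function.Bijective (erGraph n) := by
  classical
  refine ⟨fun ω ω' h => funext fun e => ?_, fun G => ⟨fun e => decide (e.1 ∈ G.edgeSet), ?_⟩⟩
  · have h := congrArg SimpleGraph.edgeSet h
    rw [edgeSet_erGraph, edgeSet_erGraph,
      (Set.image_injective.2 Subtype.val_injective).eq_iff] at h
    have := Set.ext_iff.1 h e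
    simpa [← Bool.eq_iff_iff] using this
  · rw [← edgeSet_inj, edgeSet_erGraph]
    ext e
    simpa using G.not_isDiag_of_mem_edgeSet

lemma sum_erGraph (n : ℕ) [inst : Fintype (SimpleGraph (Fin n))] (f : SimpleGraph (Fin n) → ℝ) :
    ∑ ω, f (erGraph n ω) = ∑ G, f G :=
  (erGraph_bijective n).sum_comp f

lemma prod_eq_pow_card_edgeSet (ω : {e : Sym2 (Fin n) // ¬ e.IsDiag} → Bool) (r : ℝ) :
    ∏ e, (if ω e = true then r else 1) = r ^ Nat.card (erGraph n ω).edgeSet := by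
  rw [edgeSet_erGraph, Nat.card_image_of_injective Subtype.val_injective, Finset.prod_ite]
  simp [Fintype.card_subtype]

lemma graphSum_eq (n : ℕ) (r : ℝ) : graphSum (Fin n) r = (1 + r) ^ n.choose 2 := by
  classical
  rw [graphSum, ← sum_erGraph (inst := _)]
  simp only [← prod_eq_pow_card_edgeSet]
  rw [← Fintype.piFinset_univ, ← Finset.prod_univ_sum (t := fun _ => (Finset.univ : Finset Bool))
    (f := fun _ b => if b = true then r else 1), Finset.prod_const, Finset.card_univ,
    Sym2.card_subtype_not_diag, Fintype.card_fin]
  simp [add_comm]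

lemma forestSum_le (n : ℕ) {r : ℝ} (hr : 0 ≤ r) :
    forestSum (Fin n) r ≤ (1 + r) ^ n.choose 2 := by
  classical
  rw [← graphSum_eq]
  exact Finset.sum_le_sum_of_subset_of_nonneg (Finset.filter_subset _ _) fun _ _ _ => by positivity

lemma bern_singleton {p : ℝ} (hp1 : p < 1) (b : Bool) :
    bern p {b} = ENNReal.ofReal ((1 - p) * if b = true then p / (1 - p) else 1) := by
  have : 1 - p ≠ 0 := by linarith
  cases b <;> simp [bern, mul_div_cancel₀ _ this]

lemma toReal_erMeasure (n : ℕ) {p : ℝ} (hp : 0 ≤ p) (hp1 : p < 1) :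
    (erMeasure n p {ω | (erGraph n ω).IsAcyclic}).toReal =
      (1 - p) ^ n.choose 2 * forestSum (Fin n) (p / (1 - p)) := by
  classical
  have : IsFiniteMeasure (bern p) := ⟨by simp [bern]⟩
  have h1 : 0 < 1 - p := by linarith
  have hs (ω) : erMeasure n p {ω} =
      ENNReal.ofReal ((1 - p) ^ n.choose 2 * (p / (1 - p)) ^ Nat.card (erGraph n ω).edgeSet) := by
    rw [erMeasure, Measure.pi_singleton]
    simp only [bern_singleton hp1]
    rw [← ENNReal.ofReal_prod_of_nonneg fun e _ => by split_ifs <;> positivity,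
      Finset.prod_mul_distrib, prod_eq_pow_card_edgeSet, Finset.prod_const, Finset.card_univ,
      Sym2.card_subtype_not_diag, Fintype.card_fin]
  have hset : {ω | (erGraph n ω).IsAcyclic} =
      ↑(Finset.univ.filter fun ω => (erGraph n ω).IsAcyclic) := by simp
  rw [hset, ← sum_measure_singleton, ENNReal.toReal_sum (by simp [hs]), forestSum,
    Finset.mul_sum, Finset.sum_filter, Finset.sum_filter,
    ← sum_erGraph (inst := _)]
  refine Finset.sum_congr rfl fun ω _ => ?_
  rw [hs, ENNReal.toReal_ofReal (by positivity)]

end Measure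

section UpperBound

open Filter Finset Topology

lemma choose_two_le (a j : ℕ) : (a + j + 1).choose 2 ≤ a.choose 2 + (j + 1) * (a + j) := by
  induction j with
  | zero =>
    rw [Nat.choose_succ_succ' (a + 0) 1, Nat.choose_one_right]
    simp [add_comm]
  | succ j ih =>
    rw [Nat.choose_succ_succ' (a + (j + 1)) 1, Nat.choose_one_right, ← add_assoc a j 1]
    nlinarith

lemma sum_treeCount_mul_choose_le (M K : ℕ) (hM : 0 < M) (hK : K ≤ M) :
    ∑ j ∈ range (K + 1), treeCount (Fin (j + 1)) * Real.exp (-(j + 1)) *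
      (M.choose j / (M : ℝ) ^ j) ≤ 1 := by
  have hM' : (0 : ℝ) < M := by exact_mod_cast hM
  set r : ℝ := 1 / M with hr
  have hr0 : 0 < r := by positivity
  have hY : 0 < (1 + r) ^ (M + 1).choose 2 := by positivity
  have hterm (j : ℕ) (hj : j ≤ M) : (1 + r) ^ (M + 1).choose 2 * Real.exp (-(j + 1)) ≤
      (1 + r) ^ (M - j).choose 2 := by
    have h1 : (1 + r) ^ ((j + 1) * M) ≤ Real.exp (j + 1) := by
      calc (1 + r) ^ ((j + 1) * M) ≤ Real.exp r ^ ((j + 1) * M) := by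
            gcongr
            linarith [Real.add_one_le_exp r]
        _ = Real.exp (j + 1) := by
            rw [← Real.exp_nat_mul]
            congr 1
            push_cast
            rw [hr]
            field_simp
    rw [Real.exp_neg, ← div_eq_mul_inv, div_le_iff₀ (Real.exp_pos _)]
    calc (1 + r) ^ (M + 1).choose 2 ≤ (1 + r) ^ ((M - j).choose 2 + (j + 1) * M) := by
          refine pow_le_pow_right₀ (by linarith) ?_
          have := choose_two_le (M - j) j
          rwa [Nat.sub_add_cancel hj] at this
      _ ≤ _ := by
          rw [pow_add]
          gcongr
  have h := le_graphSum_succ M hr0.le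
  rw [← sum_flip] at h
  simp only [graphSum_eq] at h
  refine le_of_mul_le_mul_left ?_ hY
  rw [mul_one, mul_sum]
  refine le_trans ?_ h
  refine (sum_le_sum_of_subset_of_nonneg (range_subset_range.2 (by omega : K + 1 ≤ M + 1))
    fun j _ _ => by positivity).trans (sum_le_sum fun j hj => ?_)
  have hj : j ≤ M := by simpa [Nat.lt_succ_iff] using hj
  rw [Nat.choose_symm hj, show M + 1 - (M - j) = j + 1 by omega, show M - (M - j) = j by omega]
  calc _ = M.choose j * (treeCount (Fin (j + 1)) * r ^ j *
        ((1 + r) ^ (M + 1).choose 2 * Real.exp (-(j + 1)))) := by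
        rw [hr, div_pow]
        ring
    _ ≤ _ := by
        gcongr
        exact hterm j hj

lemma tendsto_choose_div_pow (j : ℕ) :
    Tendsto (fun M : ℕ => (M.choose j : ℝ) / (M : ℝ) ^ j) atTop (𝓝 (1 / j.factorial)) := by
  have h := (Asymptotics.isEquivalent_iff_tendsto_one ?_).1 (isEquivalent_choose j)
  · have h' := h.mul_const (1 / (j.factorial : ℝ))
    rw [one_mul] at h'
    refine h'.congr fun M => ?_
    have : (j.factorial : ℝ) ≠ 0 := by positivity
    simp only [Pi.div_apply]
    field_simp
  · filter_upwards [eventually_gt_atTop 0] with M hM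
    positivity

/-- The tree series is at most `1` at the critical point. -/
lemma sum_treeCount_le (K : ℕ) :
    ∑ j ∈ range (K + 1), treeCount (Fin (j + 1)) * Real.exp (-(j + 1)) * (1 / j.factorial) ≤ 1 := by
  refine le_of_tendsto (tendsto_finsetSum (range (K + 1)) fun j _ =>
    (tendsto_choose_div_pow j).const_mul (treeCount (Fin (j + 1)) * Real.exp (-(j + 1)))) ?_
  filter_upwards [eventually_gt_atTop 0, eventually_ge_atTop K] with M hM hK
  exact sum_treeCount_mul_choose_le M K hM hK

lemma sq_div_two_le {u : ℝ} (hu : 0 < u) (hu1 : u ≤ 1) : u ^ 2 / 2 ≤ 1 / 2 + u * Real.log u := by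
  have h := Real.self_le_sinh_iff.2 (neg_nonneg.2 (Real.log_nonpos hu.le hu1))
  rw [Real.sinh_eq, neg_neg, Real.exp_neg, Real.exp_log hu] at h
  have h2 : u * -Real.log u ≤ u * ((u⁻¹ - u) / 2) := by gcongr
  have h3 : u * ((u⁻¹ - u) / 2) = 1 / 2 - u ^ 2 / 2 := by field_simp
  linarith

lemma pow_le_factorial_mul_exp (n : ℕ) : (n : ℝ) ^ n ≤ n.factorial * Real.exp 1 ^ n := by
  have := Real.pow_div_factorial_le_exp (n : ℝ) (by positivity) n
  rw [div_le_iff₀ (by positivity)] at this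
  rw [← Real.exp_nat_mul, mul_one, mul_comm]
  exact this

lemma factorial_mul_exp_le {n : ℕ} (hn : 0 < n) :
    n.factorial * Real.exp 1 ^ n ≤ Real.exp 1 * n * (n : ℝ) ^ n := by
  induction n, hn using Nat.le_induction with
  | base => simp
  | succ n hn ih =>
    have hn0 : (0 : ℝ) < n := by exact_mod_cast hn
    have key : Real.exp 1 * (n : ℝ) ^ (n + 1) ≤ (n + 1 : ℝ) ^ (n + 1) := by
      have h1 : (n : ℝ) / (n + 1) ≤ Real.exp (-(1 / (n + 1))) := by
        refine le_trans (le_of_eq ?_) (Real.add_one_le_exp _)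
        field_simp
        ring
      have h2 : ((n : ℝ) / (n + 1)) ^ (n + 1) ≤ Real.exp (-1) := by
        refine (pow_le_pow_left₀ (by positivity) h1 _).trans (le_of_eq ?_)
        rw [← Real.exp_nat_mul]
        congr 1
        push_cast
        field_simp
      rw [div_pow, div_le_iff₀ (by positivity)] at h2
      calc _ ≤ Real.exp 1 * (Real.exp (-1) * (n + 1) ^ (n + 1)) := by gcongr
        _ = _ := by rw [← mul_assoc, ← Real.exp_add]; simp
    rw [Nat.factorial_succ]
    push_cast
    calc (n + 1 : ℝ) * n.factorial * Real.exp 1 ^ (n + 1)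
        = (n + 1) * Real.exp 1 * (n.factorial * Real.exp 1 ^ n) := by ring
      _ ≤ (n + 1) * Real.exp 1 * (Real.exp 1 * n * (n : ℝ) ^ n) := by gcongr
      _ = Real.exp 1 * (n + 1) * (Real.exp 1 * (n : ℝ) ^ (n + 1)) := by ring
      _ ≤ Real.exp 1 * (n + 1) * (n + 1 : ℝ) ^ (n + 1) := by gcongr

lemma forestSum_le_of_mul_le_one {n : ℕ} (hn : 0 < n) {r : ℝ} (hr : 0 < r) (hrn : r * n ≤ 1) :
    forestSum (Fin n) r ≤ n.factorial * (Real.exp 1 * r) ^ n * Real.exp (1 / (2 * r)) := by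
  have hn0 : (0 : ℝ) < n := by exact_mod_cast hn
  calc forestSum (Fin n) r ≤ (1 + r) ^ n.choose 2 := forestSum_le n hr.le
    _ ≤ Real.exp r ^ n.choose 2 := by
        gcongr
        linarith [Real.add_one_le_exp r]
    _ = Real.exp (n.choose 2 * r) := by rw [Real.exp_nat_mul]
    _ ≤ Real.exp (n * Real.log (r * n) + 1 / (2 * r)) := by
        refine Real.exp_le_exp.2 ?_
        have h := sq_div_two_le (mul_pos hr hn0) hrn
        have h1 : (n.choose 2 : ℝ) * r ≤ (n : ℝ) ^ 2 / 2 * r := by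
          rw [Nat.cast_choose_two]
          gcongr
          nlinarith
        refine h1.trans ?_
        rw [← mul_le_mul_iff_right₀ hr]
        have h2 : r * (n * Real.log (r * n) + 1 / (2 * r)) =
          1 / 2 + r * n * Real.log (r * n) := by field_simp; ring
        rw [h2]
        linarith
    _ = (r * n) ^ n * Real.exp (1 / (2 * r)) := by
        rw [Real.exp_add, Real.exp_nat_mul, Real.exp_log (by positivity)]
    _ ≤ _ := by
        gcongr
        rw [mul_pow, mul_pow]
        nlinarith [pow_le_factorial_mul_exp n, pow_pos hr n]

/-- A uniform upper bound for the weight of all forests. -/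
lemma forestSum_le_exp (n : ℕ) {r : ℝ} (hr : 0 < r) :
    forestSum (Fin n) r ≤ n.factorial * (Real.exp 1 * r) ^ n * Real.exp (1 / (2 * r)) := by
  induction n using Nat.strong_induction_on with
  | _ n ih =>
    rcases n.eq_zero_or_pos with rfl | hn
    · refine (forestSum_le 0 hr.le).trans ?_
      simp only [Nat.choose_zero_succ, pow_zero, Nat.factorial_zero, Nat.cast_one, one_mul]
      exact Real.one_le_exp (by positivity)
    by_cases hrn : r * n ≤ 1
    · exact forestSum_le_of_mul_le_one hn hr hrn
    obtain ⟨m, rfl⟩ := Nat.exists_eq_add_of_le' hn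
    set E := Real.exp (1 / (2 * r)) with hE
    have hE0 : 0 < E := Real.exp_pos _
    rw [forestSum_succ, ← sum_flip]
    calc _ ≤ ∑ j ∈ range (m + 1), m.factorial * (Real.exp 1 * r) ^ m * E * Real.exp 1 *
          (treeCount (Fin (j + 1)) * Real.exp (-(j + 1)) * (1 / j.factorial)) := by
          refine sum_le_sum fun j hj => ?_
          have hj : j ≤ m := by simpa [Nat.lt_succ_iff] using hj
          rw [Nat.choose_symm hj, show m + 1 - (m - j) = j + 1 by omega,
            show m - (m - j) = j by omega]
          have h := ih (m - j) (by omega)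
          calc _ ≤ m.choose j * (treeCount (Fin (j + 1)) * r ^ j *
                ((m - j).factorial * (Real.exp 1 * r) ^ (m - j) * E)) := by gcongr
            _ = _ := by
                rw [Nat.cast_choose ℝ hj, ← Nat.sub_add_cancel hj, Nat.add_sub_cancel]
                have h1 : Real.exp (-(j + 1)) = (Real.exp 1 ^ j)⁻¹ * (Real.exp 1)⁻¹ := by
                  rw [neg_add, Real.exp_add, Real.exp_neg, Real.exp_neg, ← Real.exp_nat_mul,
                    mul_one]
                rw [h1]
                field_simp
                rw [pow_add, mul_pow _ _ j]
                ring
      _ ≤ m.factorial * (Real.exp 1 * r) ^ m * E * Real.exp 1 := by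
          rw [← mul_sum]
          exact mul_le_of_le_one_right (by positivity) (sum_treeCount_le m)
      _ ≤ m.factorial * (Real.exp 1 * r) ^ m * E * Real.exp 1 * (r * (m + 1)) := by
          refine le_mul_of_one_le_right (by positivity) ?_
          push_cast at hrn
          linarith
      _ = _ := by
          rw [Nat.factorial_succ]
          push_cast
          ring

end UpperBound

section LowerBound

open Filter Finset Topology

lemma le_forestSum_succ (m s : ℕ) {r : ℝ} (hr : 0 ≤ r) :
    (m + s).choose m * (treeCount (Fin (s + 1)) * r ^ s * forestSum (Fin m) r) ≤
      forestSum (Fin (m + s + 1)) r := by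
  rw [forestSum_succ]
  have h := single_le_sum (s := range (m + s + 1)) (f := fun k => ((m + s).choose k : ℝ) *
    (treeCount (Fin (m + s + 1 - k)) * r ^ (m + s - k) * forestSum (Fin k) r))
    (fun k _ => by have := forestSum_nonneg (V := Fin k) hr; positivity)
    (mem_range.2 (by omega : m < m + s + 1))
  have h1 : treeCount (Fin (m + s + 1 - m)) = treeCount (Fin (s + 1)) := by
    rw [show m + s + 1 - m = s + 1 by omega]
  simpa only [h1, Nat.add_sub_cancel_left] using h

lemma pow_le_choose_mul (m s : ℕ) (hm : 0 < m) :
    ((m + s + 1 : ℕ) : ℝ) ^ (m + s + 1) ≤ (m + s).choose m * treeCount (Fin (s + 1)) *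
      (Real.exp 1 ^ 2 * ((m + s + 1 : ℕ) : ℝ) ^ 4 * (m : ℝ) ^ m) := by
  have hfac : ((m + s).choose m : ℝ) * m.factorial * s.factorial = (m + s).factorial := by
    rw [Nat.choose_symm_add]
    exact_mod_cast Nat.add_choose_mul_factorial_mul_factorial m s
  have htree : ((s + 1 : ℕ) : ℝ) ^ s ≤ (s + 1 : ℕ) * treeCount (Fin (s + 1)) := by
    exact_mod_cast pow_le_mul_treeCount (V := Fin (s + 1)) s (Fintype.card_fin _)
  have hs : s.factorial * Real.exp 1 ^ (s + 1) ≤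
      Real.exp 1 * (((s + 1 : ℕ) : ℝ) ^ 2 * treeCount (Fin (s + 1))) := by
    have h := factorial_mul_exp_le s.succ_pos
    rw [Nat.factorial_succ, Nat.cast_mul] at h
    have hpos : (0 : ℝ) < (s + 1 : ℕ) := by positivity
    refine le_of_mul_le_mul_left ?_ hpos
    calc _ ≤ Real.exp 1 * (s + 1 : ℕ) * ((s + 1 : ℕ) : ℝ) ^ (s + 1) := by
          rw [← mul_assoc]
          exact h
      _ = Real.exp 1 * ((s + 1 : ℕ) : ℝ) ^ 2 * ((s + 1 : ℕ) : ℝ) ^ s := by ring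
      _ ≤ Real.exp 1 * ((s + 1 : ℕ) : ℝ) ^ 2 * ((s + 1 : ℕ) * treeCount (Fin (s + 1))) := by gcongr
      _ = _ := by ring
  have hmn : (m : ℝ) ≤ (m + s + 1 : ℕ) := by exact_mod_cast (by omega : m ≤ m + s + 1)
  have hsn : ((s + 1 : ℕ) : ℝ) ≤ (m + s + 1 : ℕ) := by exact_mod_cast (by omega)
  have hm' : m.factorial * Real.exp 1 ^ m ≤ Real.exp 1 * (m + s + 1 : ℕ) * (m : ℝ) ^ m :=
    (factorial_mul_exp_le hm).trans (by gcongr)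
  have hs' : s.factorial * Real.exp 1 ^ (s + 1) ≤
      Real.exp 1 * (((m + s + 1 : ℕ) : ℝ) ^ 2 * treeCount (Fin (s + 1))) :=
    hs.trans (by gcongr)
  refine (pow_le_factorial_mul_exp _).trans ?_
  rw [Nat.factorial_succ, Nat.cast_mul, ← hfac]
  calc _ = (m + s + 1 : ℕ) * (m + s).choose m * (m.factorial * Real.exp 1 ^ m) *
        (s.factorial * Real.exp 1 ^ (s + 1)) := by ring
    _ ≤ (m + s + 1 : ℕ) * (m + s).choose m * (Real.exp 1 * (m + s + 1 : ℕ) * (m : ℝ) ^ m) *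
        (Real.exp 1 * (((m + s + 1 : ℕ) : ℝ) ^ 2 * treeCount (Fin (s + 1)))) := by
        refine mul_le_mul (mul_le_mul_of_nonneg_left hm' ?_) hs' ?_ ?_ <;> positivity
    _ = _ := by ring

lemma pow_mul_forestSum_le {a : ℝ} {n m : ℕ} {r : ℝ} (ha : 0 < a) (hm : 0 < m) (hmn : m < n)
    (hma : a * m ≤ n) (hr : a ≤ n * r) :
    a ^ n * forestSum (Fin m) r ≤ Real.exp 1 ^ 2 * (n : ℝ) ^ 4 * r * forestSum (Fin n) r := by
  obtain ⟨s, rfl⟩ := Nat.exists_eq_add_of_lt hmn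
  set n : ℝ := ((m + s + 1 : ℕ) : ℝ) with hn
  have hn0 : 0 < n := by positivity
  have hr0 : 0 < r := pos_of_mul_pos_right (ha.trans_le hr) hn0.le
  have hF := forestSum_nonneg (V := Fin m) hr0.le
  have hm0 : (0 : ℝ) < (m : ℝ) ^ m := by positivity
  have h : a ^ (m + s + 1) ≤
      (m + s).choose m * treeCount (Fin (s + 1)) * (Real.exp 1 ^ 2 * n ^ 4) * r ^ (s + 1) := by
    refine le_of_mul_le_mul_right ?_ hm0
    calc a ^ (m + s + 1) * (m : ℝ) ^ m = (a * m) ^ m * a ^ (s + 1) := by ring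
      _ ≤ n ^ m * (n * r) ^ (s + 1) := by gcongr
      _ = n ^ (m + s + 1) * r ^ (s + 1) := by ring
      _ ≤ _ := mul_le_mul_of_nonneg_right (pow_le_choose_mul m s hm) (by positivity)
      _ = _ := by ring
  calc _ ≤ (m + s).choose m * treeCount (Fin (s + 1)) * (Real.exp 1 ^ 2 * n ^ 4) * r ^ (s + 1) *
        forestSum (Fin m) r := by gcongr
    _ = Real.exp 1 ^ 2 * n ^ 4 * r *
        ((m + s).choose m * (treeCount (Fin (s + 1)) * r ^ s * forestSum (Fin m) r)) := by ring
    _ ≤ _ := by gcongr; exact le_forestSum_succ m s hr0.le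

lemma exp_le_one_add {x : ℝ} (hx : 0 ≤ x) : Real.exp (x / (1 + x)) ≤ 1 + x := by
  rw [← Real.le_log_iff_exp_le (by linarith)]
  have := Real.one_sub_inv_le_log_of_pos (x := 1 + x) (by linarith)
  refine le_trans (le_of_eq ?_) this
  field_simp
  ring

lemma exp_le_forestSum {m : ℕ} {r : ℝ} (hr : 0 ≤ r) (hr1 : r * m < 1)
    (hr2 : r / (1 - r * m) ≤ 1) :
    Real.exp (m.choose 2 * (r * (1 - r / (1 - r * m)) / (1 + r * (1 - r / (1 - r * m))))) ≤
      forestSum (Fin m) r := by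
  have hx : 0 ≤ r * (1 - r / (1 - r * m)) := mul_nonneg hr (by linarith)
  have h := pow_le_forestSum (V := Fin m) hr (by simpa using hr1) (by
    rw [Fintype.card_fin]
    linarith)
  rw [Fintype.card_fin] at h
  refine le_trans ?_ h
  rw [Real.exp_nat_mul]
  refine pow_le_pow_left₀ (Real.exp_pos _).le ((exp_le_one_add hx).trans (le_of_eq (by ring))) _

lemma tendsto_odds (α : ℝ) :
    Tendsto (fun n : ℕ => (n : ℝ) * (α / n / (1 - α / n))) atTop (𝓝 α) := by
  have h0 : Tendsto (fun n : ℕ => α / (n : ℝ)) atTop (𝓝 0) := tendsto_const_div_atTop_nhds_zero_nat α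
  have h1 : Tendsto (fun n : ℕ => α / (1 - α / (n : ℝ))) atTop (𝓝 (α / (1 - 0))) :=
    tendsto_const_nhds.div (tendsto_const_nhds.sub h0) (by norm_num)
  rw [sub_zero, div_one] at h1
  refine h1.congr' ?_
  filter_upwards [eventually_gt_atTop 0] with n hn
  have : (n : ℝ) ≠ 0 := by positivity
  rw [div_div, ← mul_div_assoc, mul_comm (n : ℝ) (1 - _), mul_comm (1 - _) (n : ℝ),
    mul_div_mul_left _ _ this]

/-- The subcritical lower bound, for a positive fraction of the vertices. -/
lemma exists_exp_le_forestSum {r : ℕ → ℝ} {α c : ℝ} (hr0 : ∀ᶠ n in atTop, 0 ≤ r n)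
    (hr : Tendsto (fun n : ℕ => n * r n) atTop (𝓝 α)) {m : ℕ → ℕ}
    (hm : Tendsto (fun n => (m n : ℝ) / n) atTop (𝓝 c)) (hc : α * c < 1) :
    ∃ y : ℕ → ℝ, Tendsto y atTop (𝓝 (α * c ^ 2 / 2)) ∧
      ∀ᶠ n in atTop, Real.exp (n * y n) ≤ forestSum (Fin (m n)) (r n) := by
  have hinv : Tendsto (fun n : ℕ => 1 / (n : ℝ)) atTop (𝓝 0) := tendsto_const_div_atTop_nhds_zero_nat 1
  have hrz : Tendsto r atTop (𝓝 0) := by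
    have := hr.mul hinv
    rw [mul_zero] at this
    refine this.congr' ?_
    filter_upwards [eventually_gt_atTop 0] with n hn
    field_simp
  have hrm : Tendsto (fun n => r n * m n) atTop (𝓝 (α * c)) := by
    refine (hr.mul hm).congr' ?_
    filter_upwards [eventually_gt_atTop 0] with n hn
    field_simp
  have hq : Tendsto (fun n => r n / (1 - r n * m n)) atTop (𝓝 0) := by
    have := hrz.div (hrm.const_sub 1) (by linarith)
    rwa [zero_div] at this
  have hx : Tendsto (fun n => r n * (1 - r n / (1 - r n * m n))) atTop (𝓝 0) := by
    simpa using hrz.mul (hq.const_sub 1)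
  have hnx : Tendsto (fun n : ℕ => n * r n * (1 - r n / (1 - r n * m n))) atTop (𝓝 α) := by
    simpa using hr.mul (hq.const_sub 1)
  refine ⟨fun n => (m n : ℝ) / n * ((m n : ℝ) / n - 1 / n) / 2 *
    (n * r n * (1 - r n / (1 - r n * m n))) / (1 + r n * (1 - r n / (1 - r n * m n))), ?_, ?_⟩
  · have := ((((hm.mul (hm.sub hinv)).div_const 2).mul hnx)).div (hx.const_add 1) (by norm_num)
    rwa [sub_zero, add_zero, div_one, show c * c / 2 * α = α * c ^ 2 / 2 by ring] at this
  · filter_upwards [hr0, hrm.eventually_lt_const hc, hq.eventually_le_const one_pos,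
      eventually_gt_atTop 0] with n h0 h1 h2 hn
    refine le_trans (le_of_eq ?_) (exp_le_forestSum h0 h1 h2)
    rw [Nat.cast_choose_two]
    congr 1
    field_simp

end LowerBound

section Rate

open Filter Finset Topology

/-- The probability that the binomial random graph of mean degree `α` is acyclic, for `α < n`. -/
noncomputable def acyclicProb (α : ℝ) (n : ℕ) : ℝ :=
  (1 - α / n) ^ n.choose 2 * forestSum (Fin n) (α / n / (1 - α / n))

lemma tendsto_const_mul_rpow_root {c : ℝ} (hc : 0 < c) (k : ℝ) :
    Tendsto (fun n : ℕ => (c * (n : ℝ) ^ k) ^ (1 / (n : ℝ))) atTop (𝓝 1) := by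
  have h1 : Tendsto (fun n : ℕ => c ^ (1 / (n : ℝ))) atTop (𝓝 1) := by
    have := (tendsto_const_nhds (x := c)).rpow (tendsto_const_div_atTop_nhds_zero_nat 1)
      (.inl hc.ne')
    rwa [Real.rpow_zero] at this
  have h2 := (tendsto_rpow_div_mul_add k 1 0 zero_ne_one).comp
    (tendsto_natCast_atTop_atTop (R := ℝ))
  have h3 := h1.mul h2
  rw [one_mul] at h3
  refine h3.congr fun n => ?_
  rw [Real.mul_rpow hc.le (by positivity), ← Real.rpow_mul (by positivity)]
  simp [div_eq_mul_inv]

lemma tendsto_root {c : ℝ} (hc : 0 < c) (k : ℝ) {x y : ℕ → ℝ} {X Y : ℝ}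
    (hx0 : ∀ᶠ n in atTop, 0 ≤ x n) (hx : Tendsto x atTop (𝓝 X)) (hy : Tendsto y atTop (𝓝 Y)) :
    Tendsto (fun n : ℕ => (c * (n : ℝ) ^ k * x n ^ n * Real.exp (n * y n)) ^ (1 / (n : ℝ)))
      atTop (𝓝 (X * Real.exp Y)) := by
  have h := ((tendsto_const_mul_rpow_root hc k).mul hx).mul ((Real.continuous_exp.tendsto Y).comp hy)
  rw [one_mul] at h
  refine h.congr' ?_
  filter_upwards [hx0, eventually_gt_atTop 0] with n h0 hn
  have hn' : (n : ℝ) ≠ 0 := by positivity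
  rw [Real.mul_rpow (by positivity) (Real.exp_pos _).le,
    Real.mul_rpow (x := c * (n : ℝ) ^ k) (by positivity) (by positivity),
    ← Real.rpow_natCast (x n) n, ← Real.rpow_mul h0, mul_one_div_cancel hn', Real.rpow_one,
    ← Real.exp_mul, mul_right_comm (n : ℝ), mul_one_div_cancel hn', one_mul, Function.comp_apply]

lemma eventually_div_lt (α : ℝ) {b : ℝ} (hb : 0 < b) : ∀ᶠ n : ℕ in atTop, α / (n : ℝ) < b :=
  (tendsto_const_div_atTop_nhds_zero_nat α).eventually_lt_const hb

lemma exists_acyclicProb_le {α : ℝ} (hα : 0 < α) :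
    ∃ v : ℕ → ℝ, Tendsto v atTop (𝓝 (α * Real.exp (-α / 2 + 1 / (2 * α)))) ∧
      ∀ᶠ n : ℕ in atTop, acyclicProb α n ^ (1 / (n : ℝ)) ≤ v n := by
  have hinv : Tendsto (fun n : ℕ => 1 / (n : ℝ)) atTop (𝓝 0) := tendsto_const_div_atTop_nhds_zero_nat 1
  have hy : Tendsto (fun n : ℕ => -α / 2 * (1 - 1 / (n : ℝ)) + (1 / (2 * α) - 1 / n / 2)) atTop
      (𝓝 (-α / 2 + 1 / (2 * α))) := by
    simpa using ((hinv.const_sub 1).const_mul (-α / 2)).add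
      ((hinv.div_const 2).const_sub (1 / (2 * α)))
  have hp := eventually_div_lt α one_pos
  refine ⟨_, tendsto_root (Real.exp_pos 1) 1 ?_ (tendsto_odds α) hy, ?_⟩
  · filter_upwards [hp] with n hn
    have : 0 < 1 - α / n := by linarith
    positivity
  · filter_upwards [hp, eventually_gt_atTop 0] with n hn hn0
    have h1 : 0 < 1 - α / n := by linarith
    have hn' : (0 : ℝ) < n := by exact_mod_cast hn0
    have hr : 0 < α / n / (1 - α / n) := by positivity
    have hF := forestSum_nonneg (V := Fin n) hr.le
    refine Real.rpow_le_rpow (by unfold acyclicProb; positivity) ?_ (by positivity)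
    have hexp : (1 - α / n) ^ n.choose 2 ≤ Real.exp (n * (-α / 2 * (1 - 1 / n))) := by
      refine (pow_le_pow_left₀ h1.le (Real.one_sub_le_exp_neg (α / n)) _).trans (le_of_eq ?_)
      rw [← Real.exp_nat_mul, Nat.cast_choose_two]
      congr 1
      field_simp
    have hexp2 : 1 / (2 * (α / n / (1 - α / n))) = n * (1 / (2 * α) - 1 / n / 2) := by
      have : (n : ℝ) - α ≠ 0 := by
        have : α < n := by rwa [div_lt_one hn'] at hn
        linarith
      field_simp
    have hfac := factorial_mul_exp_le hn0
    rw [Real.rpow_one, mul_add, Real.exp_add, ← hexp2]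
    set r := α / n / (1 - α / n) with hrdef
    calc acyclicProb α n ≤ Real.exp (n * (-α / 2 * (1 - 1 / n))) *
          (n.factorial * (Real.exp 1 * r) ^ n * Real.exp (1 / (2 * r))) :=
          mul_le_mul hexp (forestSum_le_exp n hr) hF (Real.exp_pos _).le
      _ = n.factorial * Real.exp 1 ^ n * (r ^ n * (Real.exp (n * (-α / 2 * (1 - 1 / n))) *
          Real.exp (1 / (2 * r)))) := by ring
      _ ≤ Real.exp 1 * n * (n : ℝ) ^ n * (r ^ n * (Real.exp (n * (-α / 2 * (1 - 1 / n))) *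
          Real.exp (1 / (2 * r)))) := by gcongr
      _ = _ := by ring

lemma acyclicProb_le_one {α : ℝ} (hα : 0 < α) {n : ℕ} (hn : α / n < 1) : acyclicProb α n ≤ 1 := by
  have h1 : 0 < 1 - α / n := by linarith
  calc acyclicProb α n ≤ (1 - α / n) ^ n.choose 2 *
        (1 + α / n / (1 - α / n)) ^ n.choose 2 := by
        unfold acyclicProb
        gcongr
        exact forestSum_le n (by positivity)
    _ = 1 := by
        rw [← mul_pow, mul_add, mul_div_cancel₀ _ h1.ne']
        simp

lemma exp_le_one_sub_pow {α : ℝ} {n : ℕ} (hn0 : 0 < n) (hn : α / n < 1) :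
    Real.exp (n * (-(n * (α / n / (1 - α / n))) / 2 * (1 - 1 / n))) ≤
      (1 - α / n) ^ n.choose 2 := by
  have h1 : 0 < 1 - α / n := by linarith
  have h2 : Real.exp (-(α / n / (1 - α / n))) ≤ 1 - α / n := by
    rw [← Real.le_log_iff_exp_le h1]
    refine le_trans (le_of_eq ?_) (Real.one_sub_inv_le_log_of_pos h1)
    rw [eq_sub_iff_add_eq, inv_eq_one_div, neg_add_eq_sub, ← sub_div, div_self h1.ne']
  refine le_trans (le_of_eq ?_) (pow_le_pow_left₀ (Real.exp_pos _).le h2 _)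
  rw [← Real.exp_nat_mul, Nat.cast_choose_two]
  congr 1
  field_simp

lemma tendsto_one_sub_exponent (α : ℝ) :
    Tendsto (fun n : ℕ => -((n : ℝ) * (α / n / (1 - α / n))) / 2 * (1 - 1 / n)) atTop
      (𝓝 (-α / 2)) := by
  have hinv : Tendsto (fun n : ℕ => 1 / (n : ℝ)) atTop (𝓝 0) := tendsto_const_div_atTop_nhds_zero_nat 1
  simpa using ((tendsto_odds α).neg.div_const 2).mul (hinv.const_sub 1)

lemma eventually_odds_nonneg {α : ℝ} (hα : 0 < α) :
    ∀ᶠ n : ℕ in atTop, 0 ≤ α / (n : ℝ) / (1 - α / n) := by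
  filter_upwards [eventually_div_lt α one_pos] with n hn
  have : 0 < 1 - α / n := by linarith
  positivity

lemma exists_le_acyclicProb_of_lt_one {α : ℝ} (hα : 0 < α) (hα1 : α < 1) :
    ∃ v : ℕ → ℝ, Tendsto v atTop (𝓝 1) ∧
      ∀ᶠ n : ℕ in atTop, v n ≤ acyclicProb α n ^ (1 / (n : ℝ)) := by
  have hm : Tendsto (fun n : ℕ => (n : ℝ) / n) atTop (𝓝 1) := by
    refine tendsto_const_nhds.congr' ?_
    filter_upwards [eventually_gt_atTop 0] with n hn
    rw [div_self (by positivity)]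
  obtain ⟨y, hy, hle⟩ := exists_exp_le_forestSum (eventually_odds_nonneg hα) (tendsto_odds α)
    (m := fun n => n) hm (by linarith)
  have h := tendsto_root one_pos 0 (x := fun _ => 1) (.of_forall fun _ => zero_le_one)
    tendsto_const_nhds ((tendsto_one_sub_exponent α).add hy)
  rw [show -α / 2 + α * 1 ^ 2 / 2 = 0 by ring, Real.exp_zero, one_mul] at h
  refine ⟨_, h, ?_⟩
  filter_upwards [hle, eventually_div_lt α one_pos, eventually_gt_atTop 0] with n h1 h2 h3
  have h4 : 0 < 1 - α / n := by linarith
  refine Real.rpow_le_rpow (by positivity) ?_ (by positivity)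
  rw [Real.rpow_zero, one_pow, one_mul, one_mul, one_mul, mul_add, Real.exp_add]
  exact mul_le_mul (exp_le_one_sub_pow h3 h2) h1 (Real.exp_pos _).le (by positivity)

lemma exists_le_acyclicProb_of_one_le {α β : ℝ} (hα : 1 ≤ α) (hβ : 0 < β) (hβ1 : β < 1) :
    ∃ v : ℕ → ℝ, Tendsto v atTop (𝓝 (α * Real.exp (-α / 2 + β ^ 2 / (2 * α)))) ∧
      ∀ᶠ n : ℕ in atTop, v n ≤ acyclicProb α n ^ (1 / (n : ℝ)) := by
  have hα0 : 0 < α := by linarith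
  have hm : Tendsto (fun n : ℕ => (⌊β / α * n⌋₊ : ℝ) / n) atTop (𝓝 (β / α)) :=
    (tendsto_nat_floor_mul_div_atTop (by positivity)).comp tendsto_natCast_atTop_atTop
  obtain ⟨y, hy, hle⟩ := exists_exp_le_forestSum (eventually_odds_nonneg hα0) (tendsto_odds α)
    hm (by rwa [mul_div_cancel₀ _ hα0.ne'])
  have h := tendsto_root (c := (Real.exp 1 ^ 2 * (2 * α))⁻¹) (by positivity) (-3)
    (x := fun _ => α) (.of_forall fun _ => hα0.le)
    tendsto_const_nhds ((tendsto_one_sub_exponent α).add hy)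
  rw [show α * (β / α) ^ 2 / 2 = β ^ 2 / (2 * α) by field_simp] at h
  refine ⟨_, h, ?_⟩
  have hlarge : ∀ᶠ n : ℕ in atTop, 1 ≤ β / α * n :=
    (tendsto_natCast_atTop_atTop.const_mul_atTop (by positivity)).eventually_ge_atTop 1
  filter_upwards [hle, eventually_div_lt α one_pos, eventually_gt_atTop 0, hlarge,
    (tendsto_odds α).eventually_le_const (by linarith : α < 2 * α)] with n h1 h2 h3 h4 h5
  have hn : (0 : ℝ) < n := by exact_mod_cast h3
  have h6 : 0 < 1 - α / n := by linarith
  have h7 : 1 - α / n ≤ 1 := by linarith [div_pos hα0 hn]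
  set m := ⌊β / α * n⌋₊ with hmdef
  set r := α / n / (1 - α / n) with hr
  have hr0 : 0 < r := by positivity
  have hmle : (m : ℝ) ≤ β / α * n := Nat.floor_le (by positivity)
  have hma : α * m ≤ n := by
    calc α * m ≤ α * (β / α * n) := by gcongr
      _ = β * n := by field_simp
      _ ≤ n := mul_le_of_le_one_left hn.le hβ1.le
  have hmn : m < n := by
    have : (m : ℝ) < n := by
      refine hmle.trans_lt (mul_lt_of_lt_one_left hn ?_)
      rw [div_lt_one hα0]
      linarith
    exact_mod_cast this
  have hrn : α ≤ n * r := by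
    have : n * r = α / (1 - α / n) := by
      rw [hr]
      field_simp
    rw [this, le_div_iff₀ h6]
    nlinarith
  have hkey := pow_mul_forestSum_le hα0 (Nat.floor_pos.2 h4) hmn hma hrn
  have hFn := forestSum_nonneg (V := Fin n) hr0.le
  have hF : (Real.exp 1 ^ 2 * (2 * α))⁻¹ * (n : ℝ) ^ (-3 : ℝ) * α ^ n * forestSum (Fin m) r ≤
      forestSum (Fin n) r := by
    have h3' : (n : ℝ) ^ (-3 : ℝ) = ((n : ℝ) ^ 3)⁻¹ := by
      rw [Real.rpow_neg hn.le]
      norm_cast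
    rw [h3', ← mul_inv, mul_assoc, inv_mul_le_iff₀ (by positivity)]
    refine hkey.trans ?_
    calc Real.exp 1 ^ 2 * (n : ℝ) ^ 4 * r * forestSum (Fin n) r
        = Real.exp 1 ^ 2 * (n : ℝ) ^ 3 * (n * r) * forestSum (Fin n) r := by ring
      _ ≤ Real.exp 1 ^ 2 * (n : ℝ) ^ 3 * (2 * α) * forestSum (Fin n) r := by gcongr
      _ = _ := by ring
  refine Real.rpow_le_rpow (by positivity) ?_ (by positivity)
  rw [mul_add, Real.exp_add, mul_left_comm]
  refine mul_le_mul (exp_le_one_sub_pow h3 h2) (le_trans ?_ hF) (by positivity) (by positivity)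
  gcongr

lemma tendsto_acyclicProb_of_one_le {α : ℝ} (hα : 1 ≤ α) :
    Tendsto (fun n : ℕ => acyclicProb α n ^ (1 / (n : ℝ))) atTop
      (𝓝 (α * Real.exp (-α / 2 + 1 / (2 * α)))) := by
  refine tendsto_order.2 ⟨fun a ha => ?_, fun a ha => ?_⟩
  · have hcont : Tendsto (fun β : ℝ => α * Real.exp (-α / 2 + β ^ 2 / (2 * α))) (𝓝[<] 1)
        (𝓝 (α * Real.exp (-α / 2 + 1 ^ 2 / (2 * α)))) :=
      (Continuous.tendsto (by fun_prop) 1).mono_left nhdsWithin_le_nhds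
    rw [one_pow] at hcont
    obtain ⟨β, ⟨hβa, hβ1⟩, hβ0⟩ := (((hcont.eventually_const_lt ha).and self_mem_nhdsWithin).and
      (nhdsWithin_le_nhds (lt_mem_nhds zero_lt_one))).exists
    obtain ⟨v, hv, hle⟩ := exists_le_acyclicProb_of_one_le hα hβ0 hβ1
    filter_upwards [hle, hv.eventually_const_lt hβa] with n h1 h2
    exact h2.trans_le h1
  · obtain ⟨v, hv, hle⟩ := exists_acyclicProb_le (by linarith : 0 < α)
    filter_upwards [hle, hv.eventually_lt_const ha] with n h1 h2
    exact h1.trans_lt h2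

lemma tendsto_acyclicProb_of_lt_one {α : ℝ} (hα : 0 < α) (hα1 : α < 1) :
    Tendsto (fun n : ℕ => acyclicProb α n ^ (1 / (n : ℝ))) atTop (𝓝 1) := by
  obtain ⟨v, hv, hle⟩ := exists_le_acyclicProb_of_lt_one hα hα1
  refine tendsto_of_tendsto_of_tendsto_of_le_of_le' hv tendsto_const_nhds hle ?_
  filter_upwards [eventually_div_lt α one_pos] with n hn
  have h1 : 0 < 1 - α / n := by linarith
  refine Real.rpow_le_one ?_ (acyclicProb_le_one hα hn) (by positivity)
  exact mul_nonneg (by positivity) (forestSum_nonneg (by positivity))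

end Rate

open Filter

theorem no_cycles_rate (α : ℝ) (hα : 0 < α) :
    Tendsto
      (fun n : ℕ =>
        ((erMeasure n (α / n) {ω | (erGraph n ω).IsAcyclic}).toReal) ^ (1 / (n : ℝ)))
      atTop
      (nhds (if 1 < α then α * Real.exp (-α / 2 + 1 / (2 * α)) else 1)) := by
  have key : Tendsto (fun n : ℕ => acyclicProb α n ^ (1 / (n : ℝ))) atTop
      (nhds (if 1 < α then α * Real.exp (-α / 2 + 1 / (2 * α)) else 1)) := by
    rcases lt_trichotomy α 1 with h | rfl | h
    · rw [if_neg h.le.not_gt]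
      exact tendsto_acyclicProb_of_lt_one hα h
    · have := tendsto_acyclicProb_of_one_le (le_refl (1 : ℝ))
      norm_num at this ⊢
      exact this
    · rw [if_pos h]
      exact tendsto_acyclicProb_of_one_le h.le
  refine key.congr' ?_
  filter_upwards [eventually_div_lt α one_pos] with n hn
  rw [toReal_erMeasure n (by positivity) hn, acyclicProb]
end
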